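/- arXiv:math/0701730 — 6 statements merged into one kernel-verified Lean document; each statement's English description precedes it below -/
import Mathlib

section
/- Let (R, 𝔪) be a commutative Noetherian local ring and M a finitely generated sequentially Cohen-Macaulay R-module of dimension d with dimension filtration D_0 ⊂ D_1 ⊂ ⋯ ⊂ D_t = M, and let x_1, …, x_d be a good system of parameters of M. Then (x_1,…,x_d)M ∩ D_i = (x_1,…,x_{d_i})D_i for all i = 1, …, t−1. -/
open IsLocalRing

/-- The Krull dimension of a module, `dim M = dim R/ann M`. -/
noncomputable def moduleDim (R : Type*) [CommRing R] (M : Type*) [AddCommGroup M]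
    [Module R M] : WithBot ℕ∞ :=
  ringKrullDim (R ⧸ Module.annihilator R M)

/-- The length of a module, as the Krull dimension of its lattice of submodules. -/
noncomputable def moduleLength (R : Type*) [CommRing R] (M : Type*) [AddCommGroup M]
    [Module R M] : WithBot ℕ∞ :=
  Order.krullDim (Submodule R M)

/-- The depth of a module over a local ring: the supremum of lengths of `M`-regular
sequences consisting of elements of the maximal ideal. -/
noncomputable def moduleDepth (R : Type*) [CommRing R] [IsLocalRing R] (M : Type*)
    [AddCommGroup M] [Module R M] : ℕ∞ :=
  sSup {n : ℕ∞ | ∃ rs : List R, (rs.length : ℕ∞) = n ∧ (∀ r ∈ rs, r ∈ maximalIdeal R) ∧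
    RingTheory.Sequence.IsRegular M rs}

/-- A module over a Noetherian local ring is Cohen-Macaulay if its depth equals its
Krull dimension. -/
def IsCM (R : Type*) [CommRing R] [IsLocalRing R] (M : Type*) [AddCommGroup M]
    [Module R M] : Prop :=
  (moduleDepth R M : WithBot ℕ∞) = moduleDim R M

/-- The zeroth local cohomology `H^0_𝔪(M)`: the submodule of elements annihilated by
some power of the maximal ideal. -/
noncomputable def H0m (R : Type*) [CommRing R] [IsLocalRing R] (M : Type*) [AddCommGroup M]
    [Module R M] : Submodule R M :=
  ⨆ n : ℕ, Submodule.torsionBySet R M ((maximalIdeal R ^ n : Ideal R) : Set R)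

/-- `x : Fin d → R` is a system of parameters of `M` (where `d = dim M`):
all `x i` lie in the maximal ideal and `M/(x₁,…,x_d)M` has finite length. -/
def IsSOP (R : Type*) [CommRing R] [IsLocalRing R] (M : Type*) [AddCommGroup M] [Module R M]
    {d : ℕ} (x : Fin d → R) : Prop :=
  (∀ i, x i ∈ maximalIdeal R) ∧
    IsFiniteLength R (M ⧸ (Ideal.span (Set.range x) • (⊤ : Submodule R M)))

/-- `Λ_{s,n}`: tuples of positive integers of size `s` summing to `s + n - 1`. -/
def Lambda (s n : ℕ) : Set (Fin s → ℕ) :=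
  {α | (∀ i, 1 ≤ α i) ∧ (∑ i, α i) = s + n - 1}

/-- The sequence `x` has the property of parametric decomposition:
`q^n M = ⋂_{α ∈ Λ_{d,n}} (x₁^{α₁},…,x_d^{α_d})M` for all `n ≥ 1`, where `q = (x₁,…,x_d)`. -/
def HasParamDecomp (R : Type*) [CommRing R] (M : Type*) [AddCommGroup M] [Module R M]
    {d : ℕ} (x : Fin d → R) : Prop :=
  ∀ n : ℕ, 1 ≤ n →
    (Ideal.span (Set.range x)) ^ n • (⊤ : Submodule R M) =
      ⨅ α ∈ Lambda d n, Ideal.span (Set.range fun i => x i ^ α i) • (⊤ : Submodule R M)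

/-- `D : Fin (t+1) → Submodule R M` is the dimension filtration of `M`:
`D 0 = H^0_𝔪(M)`, `D t = M`, and each `D i` is the largest submodule of `D (i+1)` of
strictly smaller dimension. -/
def IsDimFiltration (R : Type*) [CommRing R] [IsLocalRing R] (M : Type*) [AddCommGroup M]
    [Module R M] {t : ℕ} (D : Fin (t + 1) → Submodule R M) : Prop :=
  D 0 = H0m R M ∧ D (Fin.last t) = ⊤ ∧
    ∀ i : Fin t,
      D i.castSucc ≤ D i.succ ∧
      moduleDim R ↥(D i.castSucc) < moduleDim R ↥(D i.succ) ∧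
      ∀ N : Submodule R M, N ≤ D i.succ →
        moduleDim R ↥N < moduleDim R ↥(D i.succ) → N ≤ D i.castSucc

/-- Given the dimension filtration `D` with `d_i = ds i`, a system of parameters
`x₁,…,x_d` is good if `D_i ∩ (x_{d_i+1},…,x_d)M = 0` for all `i < t`. -/
def IsGoodSOP (R : Type*) [CommRing R] [IsLocalRing R] (M : Type*) [AddCommGroup M]
    [Module R M] {d t : ℕ} (D : Fin (t + 1) → Submodule R M) (ds : Fin (t + 1) → ℕ)
    (x : Fin d → R) : Prop :=
  IsSOP R M x ∧
    ∀ i : Fin (t + 1), (i : ℕ) < t →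
      D i ⊓ (Ideal.span {r : R | ∃ j : Fin d, ds i ≤ (j : ℕ) ∧ r = x j}) •
        (⊤ : Submodule R M) = ⊥


open RingTheory.Sequence Pointwise in
theorem aux_support_finiteLength {R : Type*} [CommRing R] [IsLocalRing R]
    {M : Type*} [AddCommGroup M] [Module R M] (h : IsFiniteLength R M) :
    ∀ p ∈ Module.support R M, p.asIdeal = maximalIdeal R := by
  induction h with
  | of_subsingleton => intro p hp; simp [Module.support_eq_empty] at hp
  | @of_simple_quotient M _ _ N hs hN ih =>
    intro p hp
    rw [Module.support_of_exact (LinearMap.exact_subtype_mkQ N) N.injective_subtype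
      N.mkQ_surjective] at hp
    rcases hp with hp | hp
    · exact ih p hp
    · obtain ⟨I, hI, ⟨e⟩⟩ := isSimpleModule_iff_quot_maximal.mp hs
      rw [e.support_eq, Module.support_eq_zeroLocus, Ideal.annihilator_quotient] at hp
      have hp' : I ≤ p.asIdeal := hp
      rw [← hI.eq_of_le p.2.ne_top hp']
      exact eq_maximalIdeal hI

open RingTheory.Sequence Pointwise in
/-- a module whose support meets V(xs) only at the closed point has dimension ≤ length. -/
theorem aux_dim_le {R : Type*} [CommRing R] [IsLocalRing R] [IsNoetherianRing R]
    (xs : List R) (hm : ∀ r ∈ xs, r ∈ maximalIdeal R) :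
    ∀ {L : Type*} [AddCommGroup L] [Module R L] [Module.Finite R L],
    (∀ p ∈ Module.support R L, (∀ r ∈ xs, r ∈ p.asIdeal) → p.asIdeal = maximalIdeal R) →
    Module.supportDim R L ≤ (xs.length : WithBot ℕ∞) := by
  induction xs with
  | nil =>
    intro L _ _ _ h
    have : Subsingleton (Module.support R L) := by
      constructor
      rintro ⟨p, hp⟩ ⟨q, hq⟩
      ext1; ext1
      simp only
      rw [h p hp (by simp), h q hq (by simp)]
    simpa [Module.supportDim] using Order.krullDim_nonpos_of_subsingleton
  | cons x xs ih =>
    intro L _ _ _ h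
    refine (Module.supportDim_le_supportDim_quotSMulTop_succ
      (hm x (by simp))).trans ?_
    have := ih (fun r hr => hm r (by simp [hr])) (L := QuotSMulTop x L) ?_
    · push_cast [List.length_cons]
      gcongr
    · intro p hp hxs
      rw [Module.support_quotSMulTop] at hp
      refine h p hp.1 ?_
      have := hp.2
      simp only [PrimeSpectrum.mem_zeroLocus, Set.singleton_subset_iff, SetLike.mem_coe] at this
      simpa [this] using hxs

open RingTheory.Sequence Pointwise in
theorem aux_le_dim {R : Type*} [CommRing R] [IsLocalRing R] [IsNoetherianRing R]
    (rs : List R) (hm : ∀ r ∈ rs, r ∈ maximalIdeal R) :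
    ∀ {L : Type*} [AddCommGroup L] [Module R L] [Module.Finite R L],
    IsWeaklyRegular L rs → ∀ p ∈ associatedPrimes R L,
    (rs.length : WithBot ℕ∞) ≤ Module.supportDim R (R ⧸ p) := by
  induction rs with
  | nil =>
    intro L _ _ _ h p hp
    have := hp.isPrime
    have : Nontrivial (R ⧸ p) := Ideal.Quotient.nontrivial_iff.mpr this.ne_top
    have h2 := Module.supportDim_ne_bot_of_nontrivial R (R ⧸ p)
    obtain ⟨n, hn⟩ := WithBot.ne_bot_iff_exists.mp h2
    rw [← hn]
    simp only [List.length_nil, CharP.cast_eq_zero]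
    exact_mod_cast zero_le
  | cons y rs ih =>
    intro L _ _ _ h p hp
    have hpp := hp.isPrime
    have hym := hm y (by simp)
    rw [isWeaklyRegular_cons_iff] at h
    obtain ⟨hy, hrs⟩ := h
    obtain ⟨-, u, hu⟩ := isAssociatedPrime_iff.mp hp
    have huK : ∀ a ∈ p, a • u = 0 := by
      intro a ha; rw [hu] at ha; simpa [Submodule.mem_colon_singleton] using ha
    have hu0 : u ≠ 0 := by
      rintro rfl
      apply hpp.ne_top
      rw [hu, Ideal.eq_top_iff_one]; simp [Submodule.mem_colon_singleton]
    let K := Submodule.torsionBySet R L (p : Set R)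
    have hK : ∀ v, v ∈ K ↔ ∀ a ∈ p, a • v = 0 := by
      intro v; simp [K, Submodule.mem_torsionBySet_iff]
    let K' := K.map (y • (⊤ : Submodule R L)).mkQ
    have hK' : K' ≠ ⊥ := by
      intro h0
      have h1 : K ≤ y • (⊤ : Submodule R L) := by
        intro v hv
        have : (y • (⊤ : Submodule R L)).mkQ v ∈ K' := Submodule.mem_map_of_mem hv
        rw [h0] at this
        simpa using this
      have h2 : K ≤ maximalIdeal R • K := by
        intro v hv
        obtain ⟨w, -, rfl⟩ := (Submodule.mem_smul_pointwise_iff_exists _ _ _).mp (h1 hv)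
        refine Submodule.smul_mem_smul hym ?_
        rw [hK] at hv ⊢
        intro a ha
        apply hy
        simp only [smul_zero]
        rw [smul_comm, hv a ha]
      have := Submodule.eq_bot_of_le_smul_of_le_jacobson_bot _ _ (IsNoetherian.noetherian K) h2
        (maximalIdeal_le_jacobson _)
      have hh : u ∈ K := (hK u).mpr huK
      rw [this] at hh
      exact hu0 (by simpa using hh)
    have : Nontrivial K' := (Submodule.nontrivial_iff_ne_bot).mpr hK'
    obtain ⟨q, hq⟩ := associatedPrimes.nonempty R K'
    have hqann := IsAssociatedPrime.annihilator_le hq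
    rw [Submodule.annihilator_top] at hqann
    have hpq : p ≤ q := by
      refine le_trans ?_ hqann
      intro a ha
      rw [Module.mem_annihilator]
      rintro ⟨_, v, hv, rfl⟩
      ext1
      simp only [Submodule.coe_smul]
      rw [← map_smul, (hK v).mp hv a ha]; simp
    have hyq : y ∈ q := by
      apply hqann
      rw [Module.mem_annihilator]
      rintro ⟨_, v, hv, rfl⟩
      ext1
      simp only [Submodule.coe_smul]
      rw [← map_smul, Submodule.mkQ_apply, Submodule.coe_zero, Submodule.Quotient.mk_eq_zero]
      exact Submodule.smul_mem_pointwise_smul _ _ _ trivial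
    have hq' : q ∈ associatedPrimes R (QuotSMulTop y L) :=
      associatedPrimes.subset_of_injective K'.injective_subtype hq
    have h1 := ih (fun r hr => hm r (by simp [hr])) hrs q hq'
    have hyp : y ∉ p := fun hyp => hu0 (hy (by simpa using huK y hyp))
    have hreg : IsSMulRegular (R ⧸ p) y := by
      rw [isSMulRegular_iff_right_eq_zero_of_smul]
      intro z hz
      obtain ⟨z, rfl⟩ := Ideal.Quotient.mk_surjective z
      rw [← Ideal.Quotient.mk_eq_mk, ← Submodule.Quotient.mk_smul, Ideal.Quotient.mk_eq_mk,
        Ideal.Quotient.eq_zero_iff_mem, smul_eq_mul] at hz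
      rw [Ideal.Quotient.eq_zero_iff_mem]
      exact (hpp.mem_or_mem hz).resolve_left hyp
    rw [← Module.supportDim_quotSMulTop_succ_eq_supportDim hreg hym]
    push_cast [List.length_cons]
    gcongr
    refine h1.trans ?_
    refine Order.krullDim_le_of_strictMono
      (fun a : Module.support R (R ⧸ q) ↦ (⟨a.1, ?_⟩ : Module.support R (QuotSMulTop y (R ⧸ p)))) (fun {_ _} lt ↦ lt)
    obtain ⟨a, ha⟩ := a
    rw [Module.support_eq_zeroLocus, Ideal.annihilator_quotient] at ha
    change a ∈ _
    rw [Module.support_quotSMulTop, Module.support_eq_zeroLocus, Ideal.annihilator_quotient]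
    have ha' : q ≤ a.asIdeal := ha
    refine ⟨hpq.trans ha', ?_⟩
    simpa using ha' hyq

universe u v in
open RingTheory.Sequence Pointwise CategoryTheory Abelian in
theorem aux_exchange {R : Type u} [CommRing R] [IsLocalRing R] [IsNoetherianRing R]
    {N : Type max u v} [AddCommGroup N] [Module R N] [Module.Finite R N]
    (x : R) (hx : x ∈ maximalIdeal R) (hreg : IsSMulRegular N x)
    (rs : List R) (hm : ∀ r ∈ rs, r ∈ maximalIdeal R) (hr : IsRegular N rs) :
    ∃ rs' : List R, rs'.length = rs.length - 1 ∧ (∀ r ∈ rs', r ∈ maximalIdeal R) ∧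
      IsRegular (QuotSMulTop x N) rs' := by
  have := hr.nontrivial
  have lt : ∀ {L : Type max u v} [AddCommGroup L] [Module R L] [Module.Finite R L] [Nontrivial L],
      maximalIdeal R • (⊤ : Submodule R L) < ⊤ := by
    intro L _ _ _ _
    exact lt_of_le_of_ne le_top (Submodule.top_ne_ideal_smul_of_le_jacobson_annihilator
      (maximalIdeal_le_jacobson _)).symm
  have := nontrivial_quotSMulTop_of_mem_maximalIdeal N hx
  have h1 := ((ModuleCat.exists_isRegular_tfae (maximalIdeal R) rs.length
    (ModuleCat.of R N) lt).out 3 1 :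
      (∃ rs' : List R, rs'.length = rs.length ∧ (∀ r ∈ rs', r ∈ maximalIdeal R) ∧
        RingTheory.Sequence.IsRegular N rs') ↔ _).mp ⟨rs, rfl, hm, hr⟩
  refine ((ModuleCat.exists_isRegular_tfae (maximalIdeal R) (rs.length - 1)
    (ModuleCat.of R (QuotSMulTop x N)) lt).out 1 3).mp ?_
  intro i hi
  have e : (ModuleCat.smulShortComplex (ModuleCat.of R N) x).ShortExact :=
    IsSMulRegular.smulShortComplex_shortExact (M := ModuleCat.of R N) hreg
  have s0 := h1 i (by omega)
  have s1 := h1 (i + 1) (by omega)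
  refine subsingleton_of_forall_eq 0 fun z => ?_
  obtain ⟨w, rfl⟩ := Ext.covariant_sequence_exact₃ _ e z rfl (s1.elim _ _)
  have hw : w = 0 := s0.elim _ _
  rw [hw, Ext.zero_comp]
  rfl

universe u v in
open RingTheory.Sequence Pointwise in
theorem aux_CM {R : Type u} [CommRing R] [IsLocalRing R] [IsNoetherianRing R]
    (xs : List R) (hm : ∀ r ∈ xs, r ∈ maximalIdeal R) :
    ∀ {N : Type max u v} [AddCommGroup N] [Module R N] [Module.Finite R N]
    (rs : List R) (_ : ∀ r ∈ rs, r ∈ maximalIdeal R) (_ : IsRegular N rs)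
    (_ : xs.length ≤ rs.length)
    (_ : ∀ p ∈ Module.support R N, (∀ r ∈ xs, r ∈ p.asIdeal) → p.asIdeal = maximalIdeal R),
    IsWeaklyRegular N xs := by
  induction xs with
  | nil => intros; exact IsWeaklyRegular.nil R _
  | cons x xs ih =>
    intro N _ _ _ rs hrm hr hl hs
    have hxm := hm x (by simp)
    have hxs : ∀ r ∈ xs, r ∈ maximalIdeal R := fun r hr => hm r (by simp [hr])
    have hx : IsSMulRegular N x := by
      by_contra hx
      have : x ∈ ⋃ p ∈ associatedPrimes R N, (p : Set R) := by
        rw [biUnion_associatedPrimes_eq_compl_regular]; exact hx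
      simp only [Set.mem_iUnion, SetLike.mem_coe] at this
      obtain ⟨p, hp, hxp⟩ := this
      have h1 := aux_le_dim rs hrm hr.toIsWeaklyRegular p hp
      have h2 := aux_dim_le xs hxs (L := R ⧸ p) (by
        intro q hq hq2
        rw [Module.support_eq_zeroLocus, Ideal.annihilator_quotient] at hq
        have hq' : p ≤ q.asIdeal := hq
        refine hs q ?_ (by simpa [hq' hxp] using hq2)
        rw [Module.support_eq_zeroLocus]
        have h0 := IsAssociatedPrime.annihilator_le hp
        rw [Submodule.annihilator_top] at h0
        exact h0.trans hq')
      have h3 := h1.trans h2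
      have : rs.length ≤ xs.length := by exact_mod_cast h3
      simp at hl; omega
    obtain ⟨rs', hl', hm', hr'⟩ := aux_exchange.{u, v} x hxm hx rs hrm hr
    rw [isWeaklyRegular_cons_iff]
    refine ⟨hx, ih hxs rs' hm' hr' (by simp at hl; omega) ?_⟩
    intro p hp hxs
    rw [Module.support_quotSMulTop] at hp
    refine hs p hp.1 ?_
    have := hp.2
    simp only [PrimeSpectrum.mem_zeroLocus, Set.singleton_subset_iff, SetLike.mem_coe] at this
    simpa [this] using hxs

universe u v in
open RingTheory.Sequence Pointwise in
theorem aux_CM' {R : Type u} [CommRing R] [IsLocalRing R] [IsNoetherianRing R]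
    (xs : List R) (hm : ∀ r ∈ xs, r ∈ maximalIdeal R) 
    {N : Type v} [AddCommGroup N] [Module R N] [Module.Finite R N]
    (rs : List R) (hrm : ∀ r ∈ rs, r ∈ maximalIdeal R) (hr : IsRegular N rs)
    (hl : xs.length ≤ rs.length)
    (hs : ∀ p ∈ Module.support R N, (∀ r ∈ xs, r ∈ p.asIdeal) → p.asIdeal = maximalIdeal R) :
    IsWeaklyRegular N xs := by
  have e : ULift.{u} N ≃ₗ[R] N := ULift.moduleEquiv
  rw [← e.isWeaklyRegular_congr]
  refine aux_CM.{u, v} xs hm rs hrm ((e.isRegular_congr rs).mpr hr) hl ?_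
  rwa [e.support_eq]

/-- intersection formula. -/
theorem aux_inter {R : Type*} [CommRing R] {M : Type*} [AddCommGroup M] [Module R M]
    (xs : List R) (K P : Submodule R M) (hKP : K ≤ P)
    (h : RingTheory.Sequence.IsWeaklyRegular (P ⧸ K.comap P.subtype) xs) :
    (Ideal.ofList xs • P) ⊓ K = Ideal.ofList xs • K := by
  have hex : Function.Exact (Submodule.inclusion hKP) (K.comap P.subtype).mkQ := by
    intro z
    simp only [Submodule.mkQ_apply, Submodule.Quotient.mk_eq_zero, Submodule.mem_comap,
      Submodule.subtype_apply, Set.mem_range]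
    constructor
    · intro hz; exact ⟨⟨z, hz⟩, rfl⟩
    · rintro ⟨w, rfl⟩; exact w.2
  have H := RingTheory.Sequence.map_first_exact_on_four_term_right_exact_of_isSMulRegular_last
    (f₁ := (0 : PUnit →ₗ[R] K)) (f₂ := Submodule.inclusion hKP) (f₃ := (K.comap P.subtype).mkQ)
    (by
      intro z
      constructor
      · intro hz; exact ⟨0, by simpa using (Submodule.inclusion_injective hKP (by simpa using hz)).symm⟩
      · rintro ⟨w, rfl⟩; simp) hex (Submodule.mkQ_surjective _) h
  refine le_antisymm ?_ (le_inf (Submodule.smul_mono le_rfl hKP) Submodule.smul_le_right)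
  have key : ∀ (Q : Submodule R M) (z : Q), z.1 ∈ Ideal.ofList xs • Q ↔
      z ∈ Ideal.ofList xs • (⊤ : Submodule R Q) := by
    intro Q z
    have : Ideal.ofList xs • Q = (Ideal.ofList xs • (⊤ : Submodule R Q)).map Q.subtype := by
      rw [Submodule.map_smul'', Submodule.map_top, Submodule.range_subtype]
    rw [this, Submodule.mem_map]
    constructor
    · rintro ⟨w, hw, hwz⟩
      have : w = z := Subtype.ext hwz
      rwa [← this]
    · intro hz; exact ⟨z, hz, rfl⟩
  rintro z ⟨hz, hzK⟩
  have h0 : Submodule.mapQ _ _ _ (Submodule.smul_top_le_comap_smul_top (Ideal.ofList xs)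
      (Submodule.inclusion hKP)) (Submodule.Quotient.mk ⟨z, hzK⟩) = 0 := by
    rw [Submodule.mapQ_apply, Submodule.Quotient.mk_eq_zero]
    exact (key P ⟨z, hKP hzK⟩).mp hz
  obtain ⟨w, hw⟩ := (H _).mp h0
  obtain ⟨w, rfl⟩ := Submodule.Quotient.mk_surjective _ w
  rw [Submodule.mapQ_apply, LinearMap.zero_apply, Submodule.Quotient.mk_zero, eq_comm,
    Submodule.Quotient.mk_eq_zero] at hw
  exact (key K ⟨z, hzK⟩).mpr hw

theorem aux_moduleDim {R : Type*} [CommRing R] {M : Type*} [AddCommGroup M] [Module R M]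
    [Module.Finite R M] : moduleDim R M = Module.supportDim R M :=
  (Module.supportDim_eq_ringKrullDim_quotient_annihilator R M).symm

theorem aux_dim_quot {R : Type*} [CommRing R] [IsNoetherianRing R]
    {M : Type*} [AddCommGroup M] [Module R M] [Module.Finite R M] (K : Submodule R M) (n : ℕ)
    (h1 : (n : WithBot ℕ∞) ≤ Module.supportDim R M)
    (h2 : Module.supportDim R K < n) : (n : WithBot ℕ∞) ≤ Module.supportDim R (M ⧸ K) := by
  have hsup := Module.support_of_exact (LinearMap.exact_subtype_mkQ K) K.injective_subtype
      K.mkQ_surjective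
  obtain ⟨l, hl⟩ := Order.le_krullDim_iff.mp h1
  have hup : ∀ {L : Type _} [AddCommGroup L] [Module R L],
      l.head.1 ∈ Module.support R L → (n : WithBot ℕ∞) ≤ Module.supportDim R L := by
    intro L _ _ hh
    let l' : LTSeries (Module.support R L) :=
      ⟨l.length, fun i => ⟨(l i).1, Module.mem_support_mono (l.head_le i) hh⟩,
        fun i => l.step i⟩
    exact Order.le_krullDim_iff.mpr ⟨l', hl⟩
  rcases hsup.subset l.head.2 with h | h
  · exact absurd (hup h) (not_le.mpr h2)
  · exact hup h

theorem aux_depth {R : Type*} [CommRing R] [IsLocalRing R] {N : Type*} [AddCommGroup N]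
    [Module R N] [Module.Finite R N] (h : IsCM R N) (n : ℕ)
    (hn : (n : WithBot ℕ∞) ≤ Module.supportDim R N) :
    ∃ rs : List R, n ≤ rs.length ∧ (∀ r ∈ rs, r ∈ maximalIdeal R) ∧
      RingTheory.Sequence.IsRegular N rs := by
  unfold IsCM at h
  rw [aux_moduleDim] at h
  rcases n with _ | n
  · have : Nontrivial N := by
      rw [← Module.supportDim_ne_bot_iff_nontrivial R, ← h]
      simp
    exact ⟨[], by simp, by simp, RingTheory.Sequence.IsRegular.nil R N⟩
  · rw [← h] at hn
    have hn' : ((n + 1 : ℕ) : ℕ∞) ≤ moduleDepth R N := by exact_mod_cast hn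
    have hlt : ((n : ℕ) : ℕ∞) < moduleDepth R N := lt_of_lt_of_le (by norm_cast; omega) hn'
    obtain ⟨a, ⟨rs, rfl, h1, h2⟩, h3⟩ := lt_sSup_iff.mp hlt
    exact ⟨rs, by exact_mod_cast h3, h1, h2⟩

theorem aux_span_eq {R : Type*} [CommRing R] {M : Type*} [AddCommGroup M] [Module R M]
    {d : ℕ} (x : Fin d → R) (n : ℕ) (K : Submodule R M)
    (h : ∀ j : Fin d, n ≤ (j : ℕ) → ∀ z ∈ K, x j • z = 0) :
    Ideal.span (Set.range x) • K = Ideal.span {r : R | ∃ j : Fin d, (j : ℕ) < n ∧ r = x j} • K := by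
  apply le_antisymm
  · rw [Submodule.smul_le]
    intro r hr z hz
    induction hr using Submodule.span_induction with
    | mem r hr =>
      obtain ⟨j, rfl⟩ := hr
      by_cases hj : (j : ℕ) < n
      · exact Submodule.smul_mem_smul (Ideal.subset_span ⟨j, hj, rfl⟩) hz
      · rw [h j (by omega) z hz]; exact zero_mem _
    | zero => rw [zero_smul]; exact zero_mem _
    | add a b _ _ ha hb => rw [add_smul]; exact add_mem ha hb
    | smul c a _ ha => rw [smul_assoc]; exact Submodule.smul_mem _ c ha
  · refine Submodule.smul_mono (Ideal.span_mono ?_) le_rfl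
    rintro _ ⟨j, -, rfl⟩
    exact ⟨j, rfl⟩

theorem aux_ofList {R : Type*} [CommRing R] {d : ℕ} (x : Fin d → R) (n : ℕ) (r : R) :
    r ∈ (List.ofFn x).take n ↔ ∃ j : Fin d, (j : ℕ) < n ∧ r = x j := by
  rw [List.mem_take_iff_getElem]
  constructor
  · rintro ⟨j, hj, rfl⟩
    simp only [List.length_ofFn, lt_inf_iff] at hj
    exact ⟨⟨j, hj.2⟩, hj.1, by simp⟩
  · rintro ⟨j, hj, rfl⟩
    exact ⟨j, by simp [hj], by simp⟩

/-- **Corollary 2.3.** If `M` is sequentially Cohen-Macaulay and `x` is a good system of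
parameters, then `(x₁,…,x_d)M ∩ D_i = (x₁,…,x_{d_i})D_i` for `i = 1,…,t-1`. -/
theorem stmt_6 {R : Type*} [CommRing R] [IsLocalRing R] [IsNoetherianRing R]
    {M : Type*} [AddCommGroup M] [Module R M] [Module.Finite R M]
    {d t : ℕ} (hd : moduleDim R M = (d : WithBot ℕ∞))
    (D : Fin (t + 1) → Submodule R M) (hD : IsDimFiltration R M D)
    (ds : Fin (t + 1) → ℕ)
    (hds : ∀ i, (D i = ⊥ ∧ ds i = 0) ∨ moduleDim R ↥(D i) = (ds i : WithBot ℕ∞))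
    (hseqCM : ∀ i : Fin t, IsCM R (↥(D i.succ) ⧸ (D i.castSucc).comap (D i.succ).subtype))
    (x : Fin d → R) (hx : IsGoodSOP R M D ds x) :
    ∀ i : Fin (t + 1), 1 ≤ (i : ℕ) → (i : ℕ) < t →
      (Ideal.span (Set.range x) • (⊤ : Submodule R M)) ⊓ D i =
        Ideal.span {r : R | ∃ j : Fin d, (j : ℕ) < ds i ∧ r = x j} • D i := by
  obtain ⟨⟨hxm, hfl⟩, hgood⟩ := hx
  obtain ⟨-, hlast, hstep⟩ := hD
  -- primes of the support containing all parameters are maximal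
  have F1 : ∀ p ∈ Module.support R M, (∀ j, x j ∈ p.asIdeal) → p.asIdeal = maximalIdeal R := by
    intro p hp hxp
    apply aux_support_finiteLength hfl p
    rw [Module.support_quotient]
    refine ⟨hp, ?_⟩
    rw [PrimeSpectrum.zeroLocus_span]
    rintro _ ⟨j, rfl⟩
    exact hxp j
  have hdlast : ds (Fin.last t) = d := by
    have e : moduleDim R ↥(D (Fin.last t)) = moduleDim R M := by
      rw [aux_moduleDim, aux_moduleDim]
      exact Module.supportDim_eq_of_equiv ((LinearEquiv.ofEq _ _ hlast).trans Submodule.topEquiv)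
    rcases hds (Fin.last t) with ⟨h0, -⟩ | h
    · exfalso
      have : Subsingleton ↥(D (Fin.last t)) := by rw [h0]; infer_instance
      rw [aux_moduleDim, Module.supportDim_eq_bot_of_subsingleton, hd] at e
      exact absurd e (by simp)
    · rw [e, hd] at h
      exact_mod_cast h.symm
  -- the later parameters kill the smaller pieces
  have F2 : ∀ i : Fin (t + 1), ∀ j : Fin d, ds i ≤ (j : ℕ) → ∀ z ∈ D i, x j • z = 0 := by
    intro i j hj z hz
    rcases Nat.lt_or_ge (i : ℕ) t with hi | hi
    · have : x j • z ∈ D i ⊓ (Ideal.span {r : R | ∃ j : Fin d, ds i ≤ (j : ℕ) ∧ r = x j}) •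
          (⊤ : Submodule R M) :=
        ⟨Submodule.smul_mem _ _ hz,
          Submodule.smul_mem_smul (Ideal.subset_span ⟨j, hj, rfl⟩) trivial⟩
      rw [hgood i hi] at this
      simpa using this
    · have : i = Fin.last t := Fin.ext (by simp; omega)
      subst this
      omega
  have F3 : ∀ k : Fin t, (Ideal.span (Set.range x) • D k.succ) ⊓ D k.castSucc =
      Ideal.span (Set.range x) • D k.castSucc := by
    intro k
    obtain ⟨hle, hlt, -⟩ := hstep k
    have hdim : moduleDim R ↥(D k.succ) = (ds k.succ : WithBot ℕ∞) := by
      rcases hds k.succ with ⟨h0, -⟩ | h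
      · exfalso
        have : Subsingleton ↥(D k.succ) := by rw [h0]; infer_instance
        rw [aux_moduleDim (M := ↥(D k.succ)), Module.supportDim_eq_bot_of_subsingleton] at hlt
        exact not_lt_bot hlt
      · exact h
    set n := ds k.succ with hn
    let K := (D k.castSucc).comap (D k.succ).subtype
    have eK : K ≃ₗ[R] D k.castSucc := Submodule.comapSubtypeEquivOfLe hle
    have hQ : (n : WithBot ℕ∞) ≤ Module.supportDim R (↥(D k.succ) ⧸ K) := by
      apply aux_dim_quot K n
      · rw [← aux_moduleDim, hdim]
      · rw [Module.supportDim_eq_of_equiv eK, ← aux_moduleDim, ← hdim]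
        exact hlt
    obtain ⟨rs, hl, hrm, hr⟩ := aux_depth (hseqCM k) n hQ
    have hreg : RingTheory.Sequence.IsWeaklyRegular (↥(D k.succ) ⧸ K) ((List.ofFn x).take n) := by
      refine aux_CM' _ ?_ rs hrm hr (by simp; omega) ?_
      · intro r hr
        obtain ⟨j, -, rfl⟩ := (aux_ofList x n r).mp hr
        exact hxm j
      · intro p hp hxp
        have hp1 : p ∈ Module.support R ↥(D k.succ) :=
          Module.support_subset_of_surjective K.mkQ K.mkQ_surjective hp
        refine F1 p (Module.support_subset_of_injective _ (D k.succ).injective_subtype hp1) ?_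
        intro j
        by_cases hj : (j : ℕ) < n
        · exact hxp _ ((aux_ofList x n _).mpr ⟨j, hj, rfl⟩)
        · rw [Module.support_eq_zeroLocus] at hp1
          apply hp1
          simp only [SetLike.mem_coe, Module.mem_annihilator]
          intro z
          exact Subtype.ext (F2 k.succ j (by omega) z.1 z.2)
    have key := aux_inter _ _ _ hle hreg
    have hJ : Ideal.ofList ((List.ofFn x).take n) =
        Ideal.span {r : R | ∃ j : Fin d, (j : ℕ) < n ∧ r = x j} := by
      unfold Ideal.ofList
      congr 1
      ext r
      exact aux_ofList x n r
    rw [aux_span_eq x n (D k.succ) (F2 k.succ), aux_span_eq x n (D k.castSucc)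
      (fun j hj z hz => F2 k.succ j hj z (hle hz)), ← hJ]
    exact key
  have F4 : ∀ i : Fin (t + 1), (Ideal.span (Set.range x) • (⊤ : Submodule R M)) ⊓ D i =
      Ideal.span (Set.range x) • D i := by
    intro i
    induction i using Fin.reverseInduction with
    | last => rw [hlast, inf_top_eq]
    | cast k ih =>
      rw [← F3 k, ← ih, inf_assoc, inf_eq_right.mpr (hstep k).1]
  intro i _ _
  rw [F4 i, aux_span_eq x (ds i) (D i) (F2 i)]
end

section
/- Let (R, 𝔪) be a commutative Noetherian local ring, M a finitely generated R-module, s a positive integer, and y_1, …, y_s an M-regular sequence of elements of 𝔪. Then (y_1,…,y_s)^n M = ⋂_{(α_1,…,α_s) ∈ Λ_{s,n}} (y_1^{α_1},…,y_s^{α_s})M for all n ≥ 1. -/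
open IsLocalRing

section
open IsLocalRing RingTheory.Sequence

lemma pd_pow.{u, v} {R : Type v} [CommRing R] [IsLocalRing R] [IsNoetherianRing R] {s : ℕ} :
    ∀ {M : Type u} [AddCommGroup M] [Module R M] [Module.Finite R M]
    (y : Fin s → R) (_ : ∀ i, y i ∈ maximalIdeal R) (a : Fin s → ℕ) (_ : ∀ i, a i ≠ 0)
    (_ : IsWeaklyRegular M (List.ofFn y)), IsWeaklyRegular M (List.ofFn fun i => y i ^ a i) := by
  induction s with
  | zero => intro M _ _ _ y hy a ha h; simp
  | succ s ih =>
    intro M _ _ _ y hy a ha h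
    rw [List.ofFn_succ] at h ⊢
    rw [isWeaklyRegular_cons_iff] at h
    have h2 := ih (M := QuotSMulTop (y 0) M) (fun i => y i.succ) (fun i => hy _)
      (fun i => a i.succ) (fun i => ha _) h.2
    have h3 := (isWeaklyRegular_cons_iff M _ _).2 ⟨h.1, h2⟩
    have hm : ∀ r ∈ List.ofFn (fun i : Fin s => y i.succ ^ a i.succ), r ∈ maximalIdeal R := by
      intro r hr
      obtain ⟨i, rfl⟩ := List.mem_ofFn.1 hr
      exact Ideal.pow_mem_of_mem _ (hy _) _ (Nat.pos_of_ne_zero (ha _))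
    have h4 := IsLocalRing.isWeaklyRegular_of_perm_of_subset_maximalIdeal h3
      (List.perm_append_singleton _ _).symm (by
        intro r hr
        rcases List.mem_cons.1 hr with rfl | hr
        · exact hy _
        · exact hm r hr)
    rw [isWeaklyRegular_append_iff, isWeaklyRegular_singleton_iff] at h4
    have h5 := (isWeaklyRegular_append_iff M _ [y 0 ^ a 0]).2
      ⟨h4.1, (isWeaklyRegular_singleton_iff _ _).2 (h4.2.pow _)⟩
    refine IsLocalRing.isWeaklyRegular_of_perm_of_subset_maximalIdeal h5
      (List.perm_append_singleton _ _) ?_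
    intro r hr
    rcases List.mem_append.1 hr with hr | hr
    · exact hm r hr
    · rw [List.mem_singleton.1 hr]
      exact Ideal.pow_mem_of_mem _ (hy _) _ (Nat.pos_of_ne_zero (ha _))

lemma pd_ofList {R : Type*} [CommRing R] {s : ℕ} (y : Fin s → R) :
    Ideal.ofList (List.ofFn y) = Ideal.span (Set.range y) := by
  unfold Ideal.ofList
  congr 1
  ext r
  simp [List.mem_ofFn]

/-- the first element is regular modulo the powers of the rest. -/
lemma pd_first {R : Type*} [CommRing R] [IsLocalRing R] [IsNoetherianRing R] {s : ℕ}
    {M : Type*} [AddCommGroup M] [Module R M] [Module.Finite R M]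
    (y : Fin (s+1) → R) (hy : ∀ i, y i ∈ maximalIdeal R)
    (h : IsWeaklyRegular M (List.ofFn y)) (w : M)
    (hw : y 0 • w ∈ Ideal.span (Set.range fun i : Fin s => y i.succ) • (⊤ : Submodule R M)) :
    w ∈ Ideal.span (Set.range fun i : Fin s => y i.succ) • (⊤ : Submodule R M) := by
  rw [List.ofFn_succ] at h
  have h4 := IsLocalRing.isWeaklyRegular_of_perm_of_subset_maximalIdeal h
      (List.perm_append_singleton _ _).symm (by
        intro r hr
        rcases List.mem_cons.1 hr with rfl | hr
        · exact hy _
        · obtain ⟨i, rfl⟩ := List.mem_ofFn.1 hr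
          exact hy _)
  rw [isWeaklyRegular_append_iff, isWeaklyRegular_singleton_iff, pd_ofList] at h4
  have := h4.2
  rw [isSMulRegular_iff_right_eq_zero_of_smul] at this
  have h6 := this (Submodule.Quotient.mk w) (by
    rw [← Submodule.Quotient.mk_smul, Submodule.Quotient.mk_eq_zero]; exact hw)
  exact (Submodule.Quotient.mk_eq_zero _).1 h6

lemma pd_quot {R : Type*} [CommRing R] {M : Type*} [AddCommGroup M] [Module R M] (I : Ideal R)
    (x : R) (z : M) :
    (Submodule.Quotient.mk z : QuotSMulTop x M) ∈ I • (⊤ : Submodule R (QuotSMulTop x M)) ↔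
     z ∈ I • (⊤ : Submodule R M) ⊔ Ideal.span {x} • ⊤ := by
  have h : I • (⊤ : Submodule R (QuotSMulTop x M)) =
      Submodule.map (Submodule.mkQ _) (I • (⊤ : Submodule R M)) := by
    rw [Submodule.map_smul'', Submodule.map_top, Submodule.range_mkQ]
  rw [h, Submodule.ideal_span_singleton_smul, sup_comm, ← Submodule.comap_map_mkQ]
  rfl

lemma pd_sup_pow {R : Type*} [CommRing R] (I J : Ideal R) (n k : ℕ) (hk : k < n) :
    (I ⊔ J) ^ n ≤ I ^ (n - k) ⊔ J ^ (k + 1) := by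
  rw [← Ideal.add_eq_sup, add_pow, Ideal.sum_eq_sup, Finset.sup_le_iff]
  intro i hi
  refine Ideal.mul_le_left.trans ?_
  by_cases hik : k + 1 ≤ n - i
  · refine le_trans Ideal.mul_le_right ?_
    exact le_sup_of_le_right (Ideal.pow_le_pow_right hik)
  · have hi' : n - k ≤ i := by omega
    refine le_trans Ideal.mul_le_left ?_
    exact le_sup_of_le_left (Ideal.pow_le_pow_right hi')

theorem pd_main.{u, v} {R : Type v} [CommRing R] [IsLocalRing R] [IsNoetherianRing R] {s : ℕ} :
    ∀ {M : Type u} [AddCommGroup M] [Module R M] [Module.Finite R M]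
    (y : Fin s → R) (_ : ∀ i, y i ∈ maximalIdeal R)
    (_ : IsWeaklyRegular M (List.ofFn y)) (n : ℕ) (z : M),
    z ∈ Ideal.span (Set.range y) ^ n • (⊤ : Submodule R M) ↔
      ∀ b : Fin s → ℕ, ∑ i, b i < n →
        z ∈ Ideal.span (Set.range fun i => y i ^ (b i + 1)) • (⊤ : Submodule R M) := by
  induction s with
  | zero =>
    intro M _ _ _ y hy h n z
    rcases n with _ | n <;> simp [Set.range_eq_empty]
  | succ s ih =>
    intro M _ _ _ y hy h n z
    set q' : Ideal R := Ideal.span (Set.range fun i : Fin s => y i.succ) with hq'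
    set x := y 0 with hx
    have hspan : ∀ f : Fin (s+1) → R, Ideal.span (Set.range f) =
        Ideal.span (Set.range fun i : Fin s => f i.succ) ⊔ Ideal.span {f 0} := by
      intro f
      rw [← Ideal.span_union]
      congr 1
      ext r
      simp [Fin.exists_fin_succ, eq_comm]
    have hq : Ideal.span (Set.range y) = q' ⊔ Ideal.span {x} := hspan y
    -- quotient by a power of x
    have hquot : ∀ k m, (z ∈ q' ^ m • (⊤ : Submodule R M) ⊔ Ideal.span {x ^ (k+1)} • ⊤ ↔
        ∀ b : Fin s → ℕ, ∑ i, b i < m →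
          z ∈ Ideal.span (Set.range fun i => y i.succ ^ (b i + 1)) • (⊤ : Submodule R M) ⊔
            Ideal.span {x ^ (k+1)} • ⊤) := by
      intro k m
      have hk := pd_pow y hy (Fin.cons (k+1) fun _ => 1)
        (by intro i; refine Fin.cases ?_ (fun j => ?_) i <;> simp) h
      rw [List.ofFn_succ, isWeaklyRegular_cons_iff] at hk
      simp only [Fin.cons_zero, Fin.cons_succ, pow_one] at hk
      have hk2 : IsWeaklyRegular (QuotSMulTop (x ^ (k + 1)) M)
        (List.ofFn fun i : Fin s => y i.succ) := hk.2
      clear hk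
      generalize x ^ (k + 1) = c at hk2 ⊢
      have := ih (M := QuotSMulTop c M) (fun i => y i.succ) (fun i => hy _) hk2 m
        (Submodule.Quotient.mk z)
      simpa only [pd_quot] using this
    have hreg1 : ∀ m (w : M), x • w ∈ q' ^ m • (⊤ : Submodule R M) →
        w ∈ q' ^ m • (⊤ : Submodule R M) := by
      intro m w hw
      have htail : IsWeaklyRegular M (List.ofFn fun i : Fin s => y i.succ) := by
        have h' := h
        rw [List.ofFn_succ] at h'
        have h4 := IsLocalRing.isWeaklyRegular_of_perm_of_subset_maximalIdeal h'
          (List.perm_append_singleton _ _).symm (by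
            intro r hr
            rw [← List.ofFn_succ] at hr
            obtain ⟨i, rfl⟩ := List.mem_ofFn.1 hr
            exact hy _)
        exact ((isWeaklyRegular_append_iff M _ _).1 h4).1
      have IH := ih (M := M) (fun i => y i.succ) (fun i => hy _) htail m
      rw [hq', IH] at hw ⊢
      intro b hb
      have hk := pd_pow y hy (Fin.cons 1 fun i => b i + 1)
        (by intro i; refine Fin.cases ?_ (fun j => ?_) i <;> simp) h
      have h5 := pd_first _ (by
        intro i
        refine Ideal.pow_mem_of_mem _ (hy _) _ ?_
        refine Fin.cases ?_ (fun j => ?_) i <;> simp) hk w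
      simp only [Fin.cons_zero, Fin.cons_succ, pow_one] at h5
      exact h5 (hw b hb)
    have hreg : ∀ k m (w : M), x ^ k • w ∈ q' ^ m • (⊤ : Submodule R M) →
        w ∈ q' ^ m • (⊤ : Submodule R M) := by
      intro k m
      induction k with
      | zero => intro w hw; simpa using hw
      | succ k ihk =>
        intro w hw
        rw [pow_succ, mul_smul] at hw
        exact hreg1 m w (ihk _ hw)
    have hfwd : ∀ k < n, Ideal.span (Set.range y) ^ n • (⊤ : Submodule R M) ≤
        q' ^ (n - k) • (⊤ : Submodule R M) ⊔ Ideal.span {x ^ (k+1)} • ⊤ := by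
      intro k hk
      rw [← Submodule.sup_smul, hq, ← Ideal.span_singleton_pow]
      exact Submodule.smul_mono_left (pd_sup_pow _ _ _ _ hk)
    have key : z ∈ Ideal.span (Set.range y) ^ n • (⊤ : Submodule R M) ↔ ∀ k < n,
        z ∈ q' ^ (n - k) • (⊤ : Submodule R M) ⊔ Ideal.span {x ^ (k+1)} • ⊤ := by
      refine ⟨fun hz k hk => hfwd k hk hz, fun hz => ?_⟩
      have claim : ∀ m ≤ n, z ∈ Ideal.span (Set.range y) ^ n • (⊤ : Submodule R M) ⊔
          Ideal.span {x ^ m} • ⊤ := by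
        intro m
        induction m with
        | zero => intro _; simp
        | succ m ihm =>
          intro hm
          obtain ⟨u, hu, w', hw', huw⟩ := Submodule.mem_sup.1 (ihm (by omega))
          rw [Submodule.ideal_span_singleton_smul] at hw'
          obtain ⟨w, -, rfl⟩ := (Submodule.mem_smul_pointwise_iff_exists _ _ _).1 hw'
          have h1 := Submodule.sub_mem _ (hz m (by omega)) (hfwd m (by omega) hu)
          rw [← huw, add_sub_cancel_left] at h1
          obtain ⟨p, hp, v', hv', hpv⟩ := Submodule.mem_sup.1 h1
          rw [Submodule.ideal_span_singleton_smul] at hv'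
          obtain ⟨v, -, rfl⟩ := (Submodule.mem_smul_pointwise_iff_exists _ _ _).1 hv'
          have h2 : x ^ m • (w - x • v) = p := by
            rw [smul_sub, ← mul_smul, ← pow_succ, ← hpv, add_sub_cancel_right]
          have h3 := hreg m (n - m) (w - x • v) (h2 ▸ hp)
          have h4 : z = (u + x ^ m • (w - x • v)) + x ^ (m+1) • v := by
            rw [← huw, h2, ← hpv, add_assoc]
          rw [h4]
          refine Submodule.add_mem_sup (Submodule.add_mem _ hu ?_) (Submodule.smul_mem_smul (Ideal.mem_span_singleton_self _) trivial)
          have h5 : x ^ m • (w - x • v) ∈ Ideal.span (Set.range y) ^ m •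
              (Ideal.span (Set.range y) ^ (n - m) • (⊤ : Submodule R M)) := by
            refine Submodule.smul_mem_smul (Ideal.pow_mem_pow (Ideal.subset_span (Set.mem_range_self 0)) _) ?_
            exact Submodule.smul_mono_left (Ideal.pow_right_mono (hq ▸ le_sup_left) _) h3
          rwa [← mul_smul, ← pow_add, Nat.add_sub_cancel' (by omega)] at h5
      have h6 := claim n le_rfl
      rwa [sup_eq_left.2] at h6
      refine Submodule.smul_mono_left ?_
      rw [← Ideal.span_singleton_pow]
      exact Ideal.pow_right_mono (hq ▸ le_sup_right) _
    rw [key]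
    simp only [hquot]
    constructor
    · intro H b hb
      rw [Fin.sum_univ_succ] at hb
      have := H (b 0) (by omega) (fun i => b i.succ) (by omega)
      rwa [hspan, Submodule.sup_smul]
    · intro H k hk b hb
      have := H (Fin.cons k b) (by rw [Fin.sum_univ_succ]; simp; omega)
      rw [hspan, Submodule.sup_smul] at this
      simpa using this

end

/-- **Lemma 3.1 (Heinzer-Ratliff-Shah).** An `M`-regular sequence `y₁,…,y_s` in `𝔪`
has the property of parametric decomposition. -/
theorem stmt_7 {R : Type*} [CommRing R] [IsLocalRing R] [IsNoetherianRing R]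
    {M : Type*} [AddCommGroup M] [Module R M] [Module.Finite R M]
    {s : ℕ} (hs : 1 ≤ s) (y : Fin s → R) (hy : ∀ i, y i ∈ maximalIdeal R)
    (hreg : RingTheory.Sequence.IsRegular M (List.ofFn y)) :
    HasParamDecomp R M y := by
  intro n hn
  ext z
  rw [pd_main y hy hreg.toIsWeaklyRegular n z]
  simp only [Submodule.mem_iInf]
  constructor
  · rintro H α ⟨h1, h2⟩
    have h3 : ∀ i, α i - 1 + 1 = α i := fun i => Nat.sub_add_cancel (h1 i)
    have h4 := H (fun i => α i - 1) (by
      have h5 : ∑ i, (α i - 1 + 1) = s + n - 1 := by simp only [h3, h2]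
      rw [Finset.sum_add_distrib] at h5
      simp at h5
      omega)
    simpa only [h3] using h4
  · intro H b hb
    set i0 : Fin s := ⟨0, hs⟩
    set c : Fin s → ℕ := Pi.single i0 (n - 1 - ∑ i, b i) with hc
    have h1 := H (fun i => b i + 1 + c i) ⟨fun i => by dsimp only; omega, by
      rw [Finset.sum_add_distrib, Finset.sum_add_distrib, hc,
        Finset.sum_pi_single' i0 _ Finset.univ]
      simp
      omega⟩
    refine Submodule.smul_mono_left ?_ h1
    rw [Ideal.span_le]
    rintro _ ⟨i, rfl⟩
    simp only [pow_add _ (b i + 1) (c i)]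
    exact Ideal.mul_mem_right _ _ (Ideal.subset_span ⟨i, rfl⟩)
end

section
/- Let (R, 𝔪) be a commutative Noetherian local ring, M a finitely generated R-module of dimension d, and x_1, …, x_d a system of parameters of M having the property of parametric decomposition. Then for all 1 ≤ i < j ≤ d there exists an integer k ≥ 1 such that (x_1,…,x_i)M :_M x_j^n = (x_1,…,x_i)M + (0 :_M x_j^k) for all n ≥ k. -/
open IsLocalRing

theorem aux_expand {R : Type*} [CommRing R] {M : Type*} [AddCommGroup M] [Module R M]
    {d : ℕ} (x : Fin d → R) (n : ℕ) (w : M)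
    (hw : w ∈ (Ideal.span (Set.range x)) ^ n • (⊤ : Submodule R M)) :
    ∃ f : (Fin d → ℕ) → M,
      w = ∑ γ ∈ Finset.piAntidiag Finset.univ n, (∏ l, x l ^ γ l) • f γ := by
  induction n generalizing w with
  | zero =>
    refine ⟨fun _ => w, ?_⟩
    simp
  | succ n ih =>
    rw [pow_succ', Submodule.mul_smul] at hw
    refine Submodule.smul_induction_on hw ?_ ?_
    · intro r hr m hm
      obtain ⟨f, rfl⟩ := ih m hm
      clear hm hw
      refine Submodule.span_induction ?_ ?_ ?_ ?_ hr
      · rintro _ ⟨l, rfl⟩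
        refine ⟨fun γ => if 1 ≤ γ l then f (γ - Pi.single l 1) else 0, ?_⟩
        rw [Finset.smul_sum]
        simp only [smul_ite, smul_zero]
        rw [← Finset.sum_filter]
        refine Finset.sum_bij' (fun γ _ => γ + Pi.single l 1) (fun γ _ => γ - Pi.single l 1)
          ?_ ?_ ?_ ?_ ?_
        · intro γ h
          simp [Finset.sum_add_distrib] at h ⊢
          exact h
        · intro γ h
          simp at h ⊢
          obtain ⟨h, h1⟩ := h
          have e : γ = (γ - Pi.single l 1) + Pi.single l 1 := by
            ext t; by_cases ht : t = l
            · subst ht; simp; omega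
            · simp [ht]
          rw [e] at h
          simp [Finset.sum_add_distrib] at h
          exact h
        · intro γ h; ext t; simp
        · intro γ h
          simp at h
          ext t; by_cases ht : t = l
          · subst ht; simp; omega
          · simp [ht]
        · intro γ h
          have : γ + Pi.single l 1 - Pi.single l 1 = γ := by ext t; simp
          rw [this, ← mul_smul]
          congr 1
          simp only [Pi.add_apply, pow_add, Finset.prod_mul_distrib]
          rw [mul_comm]
          congr 1
          rw [Finset.prod_eq_single l] <;> simp +contextual
      · exact ⟨0, by simp⟩
      · rintro a b _ _ ⟨f1, h1⟩ ⟨f2, h2⟩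
        exact ⟨f1 + f2, by simp [add_smul, h1, h2, Finset.sum_add_distrib]⟩
      · rintro a b _ ⟨f1, h1⟩
        refine ⟨a • f1, ?_⟩
        rw [smul_assoc, h1, Finset.smul_sum]
        exact Finset.sum_congr rfl fun _ _ => by simp [smul_comm a]
    · rintro a b ⟨f1, h1⟩ ⟨f2, h2⟩
      exact ⟨f1 + f2, by simp [h1, h2, Finset.sum_add_distrib]⟩

theorem aux_step {R : Type*} [CommRing R] 
    {M : Type*} [AddCommGroup M] [Module R M] 
    {d : ℕ} (x : Fin d → R) (hdec : HasParamDecomp R M x) (i : ℕ) (j : Fin d) (N n : ℕ)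
    (P J : Ideal R) (hP : P = Ideal.span {r : R | ∃ l : Fin d, (l : ℕ) < i ∧ r = x l})
    (hij : i ≤ j) (hJ : J = Ideal.span {x j ^ N} * P) :
    ∀ v : M, v ∈ Ideal.span {x j ^ N} • (⊤ : Submodule R M) → v ∈ P • (⊤ : Submodule R M) →
      v ∈ J • (⊤ : Submodule R M) ⊔ (Ideal.span (Set.range x)) ^ n • (⊤ : Submodule R M) := by
  induction n with
  | zero => intro v _ _; simp
  | succ n ih =>
    intro v h1 h2
    obtain ⟨u, hu, w, hw, rfl⟩ := Submodule.mem_sup.1 (ih v h1 h2)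
    have hJ1 : J • (⊤ : Submodule R M) ≤ Ideal.span {x j ^ N} • (⊤ : Submodule R M) :=
      Submodule.smul_mono_left (hJ ▸ Ideal.mul_le_left)
    have hJ2 : J • (⊤ : Submodule R M) ≤ P • (⊤ : Submodule R M) :=
      Submodule.smul_mono_left (hJ ▸ Ideal.mul_le_right)
    have w1 := (Submodule.add_mem_iff_right _ (hJ1 hu)).1 h1
    have w2 := (Submodule.add_mem_iff_right _ (hJ2 hu)).1 h2
    refine add_mem (Submodule.mem_sup_left hu) ?_
    obtain ⟨f, hf⟩ := aux_expand x n w hw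
    have hmon : ∀ (γ β : Fin d → ℕ) (m : M), (∃ l, β l ≤ γ l) → (∏ l, x l ^ γ l) • m ∈
        Ideal.span (Set.range fun i => x i ^ β i) • (⊤ : Submodule R M) := by
      rintro γ β m ⟨l, hl⟩
      refine Submodule.smul_mem_smul ?_ trivial
      refine Ideal.mem_of_dvd _ ?_ (Ideal.subset_span ⟨l, rfl⟩)
      exact (pow_dvd_pow _ hl).trans (Finset.dvd_prod_of_mem (fun l => x l ^ γ l) (Finset.mem_univ l))
    rw [hf]
    refine Submodule.sum_mem _ fun γ hγ => ?_
    have hγn : ∑ l, γ l = n := by simpa using hγ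
    by_cases hc : N ≤ γ j ∧ ∃ l : Fin d, (l : ℕ) < i ∧ 1 ≤ γ l
    · obtain ⟨hN, l, hl, hl1⟩ := hc
      refine Submodule.mem_sup_left (Submodule.smul_mem_smul ?_ trivial)
      have hlj : l ≠ j := by rintro rfl; omega
      have hxl : x l ∈ P := by rw [hP]; exact Ideal.subset_span ⟨l, hl, rfl⟩
      rw [← Finset.mul_prod_erase _ _ (Finset.mem_univ j), hJ]
      refine Ideal.mul_mem_mul ?_ ?_
      · exact Ideal.mem_span_singleton.2 (pow_dvd_pow _ hN)
      · refine Ideal.mem_of_dvd _ ?_ hxl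
        exact (dvd_pow_self _ (by omega)).trans
          (Finset.dvd_prod_of_mem (fun l => x l ^ γ l) (by simp [hlj]))
    · refine Submodule.mem_sup_right ?_
      have hwγ : w ∈ Ideal.span (Set.range fun i => x i ^ (γ i + 1)) • (⊤ : Submodule R M) := by
        by_cases hN : N ≤ γ j
        · refine Submodule.smul_mono_left ?_ w2
          rw [hP, Ideal.span_le]
          rintro _ ⟨l, hl, rfl⟩
          have : γ l = 0 := by
            by_contra h
            exact hc ⟨hN, l, hl, by omega⟩
          exact Ideal.subset_span ⟨l, by simp [this]⟩
        · refine Submodule.smul_mono_left ?_ w1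
          rw [Ideal.span_le, Set.singleton_subset_iff]
          exact Ideal.mem_of_dvd _ (pow_dvd_pow _ (by omega)) (Ideal.subset_span ⟨j, rfl⟩)
      have hterm : (∏ l, x l ^ γ l) • f γ ∈
          Ideal.span (Set.range fun i => x i ^ (γ i + 1)) • (⊤ : Submodule R M) := by
        rw [hf, ← Finset.add_sum_erase _ _ hγ] at hwγ
        refine (Submodule.add_mem_iff_left _ ?_).1 hwγ
        refine Submodule.sum_mem _ fun γ' h' => ?_
        refine hmon γ' (fun i => γ i + 1) _ ?_
        rw [Finset.mem_erase] at h'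
        have hs : ∑ l, γ' l = n := by simpa using h'.2
        by_contra! hcon
        refine h'.1 ?_
        have := (Finset.sum_eq_sum_iff_of_le (s := Finset.univ) (f := γ') (g := γ)
          (fun l _ => by have := hcon l; omega)).1 (by omega)
        ext l; exact this l (Finset.mem_univ l)
      rw [hdec (n + 1) (by omega)]
      simp only [Submodule.mem_iInf]
      rintro β ⟨hβ1, hβ⟩
      by_cases hb : ∃ l, β l ≤ γ l
      · exact hmon _ _ _ hb
      · push Not at hb
        have hsum : ∑ l, (γ l + 1) = ∑ l, β l := by
          rw [hβ, Finset.sum_add_distrib, hγn]; simp; omega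
        have := (Finset.sum_eq_sum_iff_of_le (s := Finset.univ) (f := fun l => γ l + 1) (g := β)
          (fun l _ => by have := hb l; omega)).1 hsum
        have e : β = fun l => γ l + 1 := by
          ext l; exact (this l (Finset.mem_univ l)).symm
        rw [e]; exact hterm

theorem aux_krull {R : Type*} [CommRing R] [IsLocalRing R] [IsNoetherianRing R]
    {M : Type*} [AddCommGroup M] [Module R M] [Module.Finite R M] (I : Ideal R)
    (hI : I ≠ ⊤) (L : Submodule R M) (v : M)
    (h : ∀ n : ℕ, v ∈ L ⊔ I ^ n • (⊤ : Submodule R M)) : v ∈ L := by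
  have hk := Ideal.iInf_pow_smul_eq_bot_of_isLocalRing (M := M ⧸ L) I hI
  rw [← Submodule.Quotient.mk_eq_zero, ← Submodule.mem_bot R, ← hk, Submodule.mem_iInf]
  intro n
  obtain ⟨a, ha, b, hb, rfl⟩ := Submodule.mem_sup.1 (h n)
  have : (Submodule.Quotient.mk (a + b) : M ⧸ L) = L.mkQ b := by
    simp [(Submodule.Quotient.mk_eq_zero L).2 ha]
  rw [this]
  have h3 := Submodule.mem_map_of_mem (f := L.mkQ) hb
  rw [Submodule.map_smul''] at h3
  exact Submodule.smul_mono le_rfl le_top h3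

theorem stmt_12 {R : Type*} [CommRing R] [IsLocalRing R] [IsNoetherianRing R]
    {M : Type*} [AddCommGroup M] [Module R M] [Module.Finite R M]
    {d : ℕ} (hd : moduleDim R M = (d : WithBot ℕ∞))
    (x : Fin d → R) (hx : IsSOP R M x) (hdec : HasParamDecomp R M x) :
    ∀ (i : ℕ) (j : Fin d), 1 ≤ i → i ≤ (j : ℕ) →
      ∃ k : ℕ, 1 ≤ k ∧ ∀ n : ℕ, k ≤ n →
        Submodule.comap ((x j ^ n) • (LinearMap.id : M →ₗ[R] M))
            (Ideal.span {r : R | ∃ l : Fin d, (l : ℕ) < i ∧ r = x l} •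
              (⊤ : Submodule R M)) =
          Ideal.span {r : R | ∃ l : Fin d, (l : ℕ) < i ∧ r = x l} •
              (⊤ : Submodule R M) ⊔
            Submodule.torsionBy R M (x j ^ k) := by
  intro i j _ hij
  set P := Ideal.span {r : R | ∃ l : Fin d, (l : ℕ) < i ∧ r = x l} with hP
  have hmono : Monotone fun k : ℕ => Submodule.torsionBy R M (x j ^ k) := by
    intro a b hab m hm
    rw [Submodule.mem_torsionBy_iff] at hm ⊢
    obtain ⟨c, rfl⟩ := Nat.exists_eq_add_of_le' hab
    rw [pow_add, mul_smul, hm, smul_zero]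
  obtain ⟨k0, hk0⟩ := monotone_stabilizes_iff_noetherian.2 (inferInstance : IsNoetherian R M)
    ⟨_, hmono⟩
  refine ⟨k0 + 1, by omega, fun n hn => ?_⟩
  have hst : Submodule.torsionBy R M (x j ^ n) = Submodule.torsionBy R M (x j ^ (k0 + 1)) :=
    (hk0 n (by omega)).symm.trans (hk0 (k0 + 1) (by omega))
  rw [← hst]
  apply le_antisymm
  · intro a ha
    have ha' : x j ^ n • a ∈ P • (⊤ : Submodule R M) := by simpa using ha
    have hq : Ideal.span (Set.range x) ≠ ⊤ := by
      intro h
      have : Ideal.span (Set.range x) ≤ maximalIdeal R := by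
        rw [Ideal.span_le]; rintro _ ⟨l, rfl⟩; exact hx.1 l
      rw [h] at this
      exact (maximalIdeal.isMaximal R).ne_top (top_le_iff.1 this)
    have hmem := aux_krull _ hq _ (x j ^ n • a) fun t =>
      aux_step x hdec i j n t P _ hP hij rfl (x j ^ n • a)
        (Submodule.smul_mem_smul (Ideal.mem_span_singleton_self _) trivial) ha'
    rw [Submodule.mul_smul, Submodule.ideal_span_singleton_smul] at hmem
    obtain ⟨b, hb, hb'⟩ := hmem
    have hb' : x j ^ n • b = x j ^ n • a := hb'
    refine Submodule.mem_sup.2 ⟨b, hb, a - b, ?_, by abel⟩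
    rw [Submodule.mem_torsionBy_iff, smul_sub, hb', sub_self]
  · refine sup_le ?_ ?_
    · intro a ha
      simpa using Submodule.smul_mem _ _ ha
    · intro a ha
      rw [Submodule.mem_torsionBy_iff] at ha
      simp [ha]
end

section
/- Let (R, 𝔪) be a commutative Noetherian local ring and M a finitely generated R-module of dimension d ≥ 1. Then M possesses a good system of parameters; i.e. there exist x_1, …, x_d ∈ 𝔪 forming a system of parameters of M such that D_i ∩ (x_{d_i+1},…,x_d)M = 0 for all i = 0,…,t−1, where D_0 ⊂ D_1 ⊂ ⋯ ⊂ D_t = M is the dimension filtration of M and d_i = dim D_i. -/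
open IsLocalRing

lemma coheight_le_ringKrullDim_quotient {R : Type*} [CommRing R] (I : Ideal R)
    (p : PrimeSpectrum R) (h : I ≤ p.asIdeal) :
    (Order.coheight p : WithBot ℕ∞) ≤ ringKrullDim (R ⧸ I) := by
  rw [ringKrullDim_quotient, Order.coheight_eq_krullDim_Ici]
  have hs : Set.Ici p ⊆ PrimeSpectrum.zeroLocus (R := R) I := fun q hq =>
    h.trans hq
  exact Order.krullDim_le_of_strictMono (Set.inclusion hs) (fun a b hab => hab)

/-- Choice of parameters in prescribed ideals. -/
lemma exists_params {R : Type*} [CommRing R] [IsNoetherianRing R] (B : ℕ → Ideal R)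
    (hB : ∀ j, ∀ p : PrimeSpectrum R, B j ≤ p.asIdeal → Order.coheight p ≤ (j : ℕ∞))
    (d : ℕ) : ∀ (I : Ideal R),
    (∀ p : PrimeSpectrum R, I ≤ p.asIdeal → Order.coheight p ≤ (d : ℕ∞)) →
    ∃ x : ℕ → R, (∀ j < d, x j ∈ B j) ∧
      ∀ p : PrimeSpectrum R, I ≤ p.asIdeal → (∀ j < d, x j ∈ p.asIdeal) →
        Order.coheight p = 0 := by
  induction d with
  | zero =>
    intro I hI
    exact ⟨0, by simp, fun p hp _ => by simpa using hI p hp⟩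
  | succ d ih =>
    intro I hI
    have hfin : {p ∈ I.minimalPrimes | ¬ B d ≤ p}.Finite :=
      (I.finite_minimalPrimes_of_isNoetherianRing R).subset (fun _ h => h.1)
    have hav : ¬ ((B d : Set R) ⊆ ⋃ p ∈ {p ∈ I.minimalPrimes | ¬ B d ≤ p}, (p : Set R)) := by
      intro h
      obtain ⟨p, hp, hp'⟩ := (Ideal.subset_union_prime_finite hfin (f := id) ⊥ ⊥
        (fun p hp _ _ => hp.1.1.1)).1 h
      exact hp.2 hp'
    obtain ⟨y, hyB, hy⟩ := Set.not_subset.1 hav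
    obtain ⟨x, hx, hx'⟩ := ih (I ⊔ Ideal.span {y}) (by
      intro q hq
      obtain ⟨p, hp, hpq⟩ := Ideal.exists_minimalPrimes_le (le_sup_left.trans hq)
      let P : PrimeSpectrum R := ⟨p, hp.1.1⟩
      by_cases hBp : B d ≤ p
      · exact (Order.coheight_anti (show P ≤ q from hpq)).trans (hB d P hBp)
      · have hyp : y ∉ p := fun hyp => hy (Set.mem_biUnion (x := p) ⟨hp, hBp⟩ hyp)
        have hyq : y ∈ q.asIdeal :=
          hq (le_sup_right (a := I) (Ideal.mem_span_singleton_self y))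
        have hlt : P < q := lt_of_le_of_ne hpq (fun e => hyp (by rw [← e] at hyq; exact hyq))
        have h1 := (Order.coheight_add_one_le hlt).trans (hI P hp.1.2)
        push_cast at h1
        exact (ENat.add_le_add_iff_right (by simp)).1 h1)
    refine ⟨Function.update x d y, ?_, ?_⟩
    · intro j hj
      by_cases h : j = d
      · subst h; simpa using hyB
      · rw [Function.update_of_ne h]; exact hx j (by omega)
    · intro p hp hj
      refine hx' p (sup_le hp ?_) ?_
      · rw [Ideal.span_singleton_le_iff_mem]
        simpa using hj d (by omega)
      · intro j hjd
        have := hj j (by omega)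
        rwa [Function.update_of_ne (by omega)] at this

lemma isFiniteLength_of_torsion {R : Type*} [CommRing R] [IsNoetherianRing R]
    {N : Type*} [AddCommGroup N] [Module R N] [Module.Finite R N] (J : Ideal R)
    (hJ : ∀ p : PrimeSpectrum R, J ≤ p.asIdeal → Order.coheight p = 0)
    (hN : Module.IsTorsionBySet R N J) : IsFiniteLength R N := by
  rw [isFiniteLength_iff_isNoetherian_isArtinian]
  refine ⟨inferInstance, ?_⟩
  have : IsArtinianRing (R ⧸ J) := by
    rw [isArtinianRing_iff_krullDimLE_zero, Ring.krullDimLE_iff, ringKrullDim_quotient]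
    refine Order.krullDim_nonpos_iff_forall_isMax.mpr ?_
    rintro ⟨p, hp⟩ ⟨q, hq⟩ hpq
    exact (Order.coheight_eq_zero.1 (hJ p hp)) hpq
  letI := hN.module
  haveI : IsScalarTower R (R ⧸ J) N := hN.isScalarTower
  haveI : Module.Finite (R ⧸ J) N := Module.Finite.of_restrictScalars_finite R _ _
  exact isArtinian_of_surjective_algebraMap (R := R ⧸ J) Ideal.Quotient.mk_surjective

/-- Artin-Rees consequence. -/
lemma exists_pow_annihilator_inf {R : Type*} [CommRing R] [IsNoetherianRing R]
    {M : Type*} [AddCommGroup M] [Module R M] [Module.Finite R M] (N : Submodule R M) :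
    ∃ n : ℕ, N ⊓ (Module.annihilator R N) ^ n • (⊤ : Submodule R M) = ⊥ := by
  obtain ⟨k, hk⟩ := Ideal.exists_pow_inf_eq_pow_smul (Module.annihilator R N) N
  refine ⟨k + 1, ?_⟩
  rw [inf_comm, hk (k + 1) (by omega), Nat.add_sub_cancel_left, pow_one, eq_bot_iff]
  refine (Submodule.smul_mono le_rfl inf_le_right).trans ?_
  rw [Submodule.smul_le]
  intro r hr n hn
  have := Module.mem_annihilator.1 hr ⟨n, hn⟩
  simpa using congrArg Subtype.val this

/-- Every finitely generated module of positive dimension over a Noetherian local ring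
possesses a good system of parameters. -/
theorem stmt_14 {R : Type*} [CommRing R] [IsLocalRing R] [IsNoetherianRing R]
    {M : Type*} [AddCommGroup M] [Module R M] [Module.Finite R M]
    {d t : ℕ} (hd : moduleDim R M = (d : WithBot ℕ∞)) (hd1 : 1 ≤ d)
    (D : Fin (t + 1) → Submodule R M) (hD : IsDimFiltration R M D)
    (ds : Fin (t + 1) → ℕ)
    (hds : ∀ i, (D i = ⊥ ∧ ds i = 0) ∨ moduleDim R ↥(D i) = (ds i : WithBot ℕ∞)) :
    ∃ x : Fin d → R, IsGoodSOP R M D ds x := by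
  choose n hn using fun i => exists_pow_annihilator_inf (R := R) (D i)
  classical
  let B : ℕ → Ideal R := fun j => maximalIdeal R ⊓
    (Finset.univ.filter fun i => ds i ≤ j).inf fun i => Module.annihilator R (D i) ^ n i
  obtain ⟨x, hxB, hx⟩ := exists_params B (by
    intro j p hp
    rcases p.2.inf_le.1 hp with h | h
    · have hm := (maximalIdeal.isMaximal R).eq_of_le p.2.ne_top h
      have : IsMax p := fun q hq => by
        have := (maximalIdeal.isMaximal R).eq_of_le q.2.ne_top (h.trans hq)
        change q.asIdeal ≤ p.asIdeal
        rw [← this, ← hm]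
      rw [Order.coheight_eq_zero.2 this]
      exact zero_le
    · obtain ⟨i, hi, hip⟩ := p.2.inf_le'.1 h
      have hi : ds i ≤ j := by simpa using hi
      have hip := p.2.le_of_pow_le hip
      rcases hds i with ⟨h0, -⟩ | h1
      · exfalso
        apply p.2.ne_top
        rw [Ideal.eq_top_iff_one]
        apply hip
        rw [Module.mem_annihilator]
        rintro ⟨m, hm⟩
        rw [h0] at hm
        ext
        simpa using hm
      · have := coheight_le_ringKrullDim_quotient _ p hip
        rw [moduleDim] at h1
        rw [h1] at this
        have h2 : Order.coheight p ≤ (ds i : ℕ∞) := by exact_mod_cast this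
        exact h2.trans (by exact_mod_cast hi)) d (Module.annihilator R M) (by
    intro p hp
    have := coheight_le_ringKrullDim_quotient _ p hp
    rw [moduleDim] at hd
    rw [hd] at this
    exact_mod_cast this)
  refine ⟨fun j => x j, ⟨fun j => (hxB j j.2).1, ?_⟩, ?_⟩
  · refine isFiniteLength_of_torsion (Module.annihilator R M ⊔
      Ideal.span (Set.range fun j : Fin d => x j)) ?_ ?_
    · intro p hp
      refine hx p (le_sup_left.trans hp) fun j hj => ?_
      exact (le_sup_right.trans hp) (Ideal.subset_span ⟨⟨j, hj⟩, rfl⟩)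
    · rw [Module.isTorsionBySet_iff_subset_annihilator, SetLike.coe_subset_coe]
      refine sup_le ?_ ?_
      · exact (Submodule.mkQ _).annihilator_le_of_surjective (Submodule.mkQ_surjective _)
      · rw [← SetLike.coe_subset_coe, ← Module.isTorsionBySet_iff_subset_annihilator]
        exact Module.isTorsionBySet_quotient_ideal_smul M _
  · intro i _
    rw [eq_bot_iff, ← hn i]
    refine inf_le_inf_left _ (Submodule.smul_mono_left ?_)
    rw [Ideal.span_le]
    rintro r ⟨j, hj, rfl⟩
    exact (Finset.inf_le (f := fun i => Module.annihilator R (D i) ^ n i)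
      (by simpa using hj)) (hxB j j.2).2
end

section
/- Let (R, 𝔪) be a commutative Noetherian local ring, M a finitely generated sequentially Cohen-Macaulay R-module with dimension filtration D_0 ⊂ D_1 ⊂ ⋯ ⊂ D_t = M, and let q be a good parameter ideal of M. Then q^n M ∩ D_i = q^n D_i for all n ≥ 1 and all i = 0, …, t. -/
open IsLocalRing

namespace SeqCM
open Pointwise

lemma pow_succ_sup {R : Type*} [CommRing R] (I : Ideal R) (w : R) (n : ℕ) :
    (I ⊔ Ideal.span {w}) ^ (n + 1) =
      I ^ (n + 1) ⊔ Ideal.span {w} * (I ⊔ Ideal.span {w}) ^ n := by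
  induction n with
  | zero => simp
  | succ n ih =>
    have h1 : (I ⊔ Ideal.span {w}) ^ (n + 2) = (I ⊔ Ideal.span {w}) * (I ⊔ Ideal.span {w}) ^ (n+1) := by
      rw [pow_succ']
    rw [h1, Ideal.sup_mul]
    apply le_antisymm
    · refine sup_le ?_ le_sup_right
      conv_lhs => rw [ih]
      rw [Ideal.mul_sup]
      refine sup_le (le_sup_of_le_left (by rw [← pow_succ'])) (le_sup_of_le_right ?_)
      rw [mul_left_comm, pow_succ' (I ⊔ Ideal.span {w}) n]
      exact Ideal.mul_mono_right (Ideal.mul_mono_left le_sup_left)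
    · refine sup_le (le_sup_of_le_left ?_) le_sup_right
      rw [pow_succ' I]
      exact Ideal.mul_mono_right (Ideal.pow_right_mono le_sup_left _)

lemma mem_decomp {R C : Type*} [CommRing R] [AddCommGroup C] [Module R C]
    {I J : Ideal R} {w : R} {n : ℕ} {a : C}
    (h : a ∈ ((I ⊔ Ideal.span {w}) ^ (n + 1) * J) • (⊤ : Submodule R C)) :
    ∃ a' ∈ (I ^ (n+1) * J) • (⊤ : Submodule R C),
      ∃ b ∈ ((I ⊔ Ideal.span {w}) ^ n * J) • (⊤ : Submodule R C), a = a' + w • b := by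
  rw [pow_succ_sup, Ideal.sup_mul, Submodule.sup_smul] at h
  obtain ⟨a', ha', c, hc, rfl⟩ := Submodule.mem_sup.1 h
  rw [mul_assoc, mul_smul, Submodule.ideal_span_singleton_smul] at hc
  obtain ⟨b, hb, rfl⟩ := (Submodule.mem_smul_pointwise_iff_exists _ _ _).1 hc
  exact ⟨a', ha', b, hb, rfl⟩

lemma mem_decomp' {R C : Type*} [CommRing R] [AddCommGroup C] [Module R C]
    {I : Ideal R} {w : R} {n : ℕ} {a : C}
    (h : a ∈ ((I ⊔ Ideal.span {w}) ^ (n + 1)) • (⊤ : Submodule R C)) :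
    ∃ a' ∈ (I ^ (n+1)) • (⊤ : Submodule R C),
      ∃ b ∈ ((I ⊔ Ideal.span {w}) ^ n) • (⊤ : Submodule R C), a = a' + w • b := by
  have := mem_decomp (J := ⊤) (a := a) (I := I) (w := w) (n := n)
  simp only [Ideal.mul_top] at this
  exact this h

/-- Elements regular modulo `IC` are regular modulo `I^n C` if they are regular on graded pieces. -/
lemma colon_of_graded {R C : Type*} [CommRing R] [AddCommGroup C] [Module R C] (I : Ideal R)
    (x : R)
    (h : ∀ n, ∀ a ∈ I ^ n • (⊤ : Submodule R C), x • a ∈ (I ^ n * I) • (⊤ : Submodule R C) →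
      a ∈ (I ^ n * I) • (⊤ : Submodule R C)) (n : ℕ) (c : C)
    (hc : x • c ∈ I ^ n • (⊤ : Submodule R C)) : c ∈ I ^ n • (⊤ : Submodule R C) := by
  induction n with
  | zero => simp
  | succ n ih =>
    rw [pow_succ] at hc ⊢
    refine h n c (ih ?_) hc
    have hle : I ^ n * I ≤ I ^ n := Ideal.mul_le_left
    exact Submodule.smul_mono_left hle hc

lemma graded_reg {R C : Type*} [CommRing R] [AddCommGroup C] [Module R C]
    (f : ℕ → R) (I : ℕ → Ideal R) (h0 : I 0 = ⊥) (hS : ∀ k, I (k+1) = I k ⊔ Ideal.span {f k})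
    (s : ℕ) (reg : ∀ k < s, ∀ c : C, f k • c ∈ I k • (⊤ : Submodule R C) →
      c ∈ I k • (⊤ : Submodule R C)) :
    ∀ k ≤ s, ∀ n : ℕ, ∀ J : Ideal R, I k ≤ J → ∀ x : R,
      (∀ c : C, x • c ∈ J • (⊤ : Submodule R C) → c ∈ J • (⊤ : Submodule R C)) →
      ∀ a ∈ I k ^ n • (⊤ : Submodule R C), x • a ∈ (I k ^ n * J) • (⊤ : Submodule R C) →
      a ∈ (I k ^ n * J) • (⊤ : Submodule R C) := by
  intro k
  induction k with
  | zero =>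
    intro _ n J hJ x hx a ha hxa
    cases n with
    | zero => simpa using hx a (by simpa using hxa)
    | succ n =>
      rw [h0] at ha
      have : a = 0 := by simpa [Ideal.bot_pow] using ha
      rw [this]; exact zero_mem _
  | succ k ihk =>
    intro hk n J hJ x hx
    have hIk : I k ≤ I (k+1) := by rw [hS]; exact le_sup_left
    have hfk : f k ∈ I (k+1) := by
      rw [hS]; exact Ideal.mem_sup_right (Ideal.mem_span_singleton_self _)
    have hcol := colon_of_graded (I k) (f k)
      (fun n => ihk (by omega) n (I k) le_rfl (f k) (reg k (by omega)))

    have key : ∀ m : ℕ, ∀ u : C, u ∈ I k ^ m • (⊤ : Submodule R C) →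
        f k • u ∈ (I k ^ m * J) • (⊤ : Submodule R C) := by
      intro m u hu
      rw [mul_comm, mul_smul]
      exact Submodule.smul_mem_smul (hJ hfk) hu
    induction n with
    | zero =>
      intro a ha hxa
      simpa using hx a (by simpa using hxa)
    | succ n ihn =>
      intro a ha hxa
      rw [hS] at ha hxa
      obtain ⟨a', ha', b, hb, rfl⟩ := mem_decomp' ha
      obtain ⟨e, he, g, hg, hxe⟩ := mem_decomp hxa
      rw [← hS] at hb hg hxa
      have heI : e ∈ I k ^ (n+1) • (⊤ : Submodule R C) :=
        Submodule.smul_mono_left Ideal.mul_le_left he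
      have h1 : x • b - g ∈ I k ^ (n+1) • (⊤ : Submodule R C) := by
        apply hcol
        have : f k • (x • b - g) = e - x • a' := by
          rw [smul_sub, smul_comm (f k) x b, sub_eq_sub_iff_add_eq_add, ← hxe, smul_add]
          abel
        rw [this]
        exact sub_mem heI (Submodule.smul_mem _ _ ha')
      have h2 : I k ^ (n+1) • (⊤ : Submodule R C) ≤ (I (k+1) ^ n * J) • (⊤ : Submodule R C) := by
        rw [pow_succ]
        exact Submodule.smul_mono_left (Ideal.mul_mono (Ideal.pow_right_mono hIk n) (hIk.trans hJ))
      have h3 : b ∈ (I (k+1) ^ n * J) • (⊤ : Submodule R C) := by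
        apply ihn b hb
        have := add_mem (h2 h1) hg
        simpa using this
      have h4 : f k • b ∈ (I (k+1) ^ (n+1) * J) • (⊤ : Submodule R C) := by
        rw [pow_succ', mul_assoc, mul_smul]
        exact Submodule.smul_mem_smul hfk h3
      refine add_mem ?_ h4
      have h5 : x • a' ∈ (I (k+1) ^ (n+1) * J) • (⊤ : Submodule R C) := by
        have := sub_mem hxa (Submodule.smul_mem _ x h4)
        simpa [smul_add] using this
      rw [hS] at h5
      obtain ⟨e', he', g', hg', hxe'⟩ := mem_decomp h5
      have he'I : e' ∈ I k ^ (n+1) • (⊤ : Submodule R C) :=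
        Submodule.smul_mono_left Ideal.mul_le_left he'
      have h6 : g' ∈ I k ^ (n+1) • (⊤ : Submodule R C) := by
        apply hcol
        have : f k • g' = x • a' - e' := by rw [hxe']; abel
        rw [this]
        exact sub_mem (Submodule.smul_mem _ _ ha') he'I
      have h7 : a' ∈ (I k ^ (n+1) * J) • (⊤ : Submodule R C) := by
        apply ihk (by omega) (n+1) J (hIk.trans hJ) x hx a' ha'
        rw [hxe']
        exact add_mem he' (key _ _ h6)
      exact Submodule.smul_mono_left (Ideal.mul_mono_left (Ideal.pow_right_mono hIk _)) h7

lemma inter_pow {R N : Type*} [CommRing R] [AddCommGroup N] [Module R N] (L : Submodule R N)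
    (f : ℕ → R) (I : ℕ → Ideal R) (h0 : I 0 = ⊥) (hS : ∀ k, I (k+1) = I k ⊔ Ideal.span {f k})
    (s : ℕ) (reg : ∀ k < s, ∀ c : N ⧸ L, f k • c ∈ I k • (⊤ : Submodule R (N ⧸ L)) →
      c ∈ I k • (⊤ : Submodule R (N ⧸ L))) :
    ∀ k ≤ s, ∀ n : ℕ, ∀ z ∈ L, z ∈ I k ^ n • (⊤ : Submodule R N) → z ∈ I k ^ n • L := by
  intro k
  induction k with
  | zero =>
    intro _ n z hzL hz
    cases n with
    | zero => simpa using hzL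
    | succ n =>
      rw [h0] at hz
      have : z = 0 := by simpa [Ideal.bot_pow] using hz
      rw [this]; exact zero_mem _
  | succ k ihk =>
    intro hk n
    have hIk : I k ≤ I (k+1) := by rw [hS]; exact le_sup_left
    have hfk : f k ∈ I (k+1) := by
      rw [hS]; exact Ideal.mem_sup_right (Ideal.mem_span_singleton_self _)
    have hcol := colon_of_graded (C := N ⧸ L) (I k) (f k)
      (fun n => graded_reg f I h0 hS s reg k (by omega) n (I k) le_rfl (f k) (reg k (by omega)))
    have hmap : ∀ K : Ideal R, (K • (⊤ : Submodule R N)).map L.mkQ = K • (⊤ : Submodule R (N ⧸ L)) := by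
      intro K
      rw [Submodule.map_smul'', Submodule.map_top, Submodule.range_mkQ]
    induction n with
    | zero => intro z hz _; simpa using hz
    | succ n ihn =>
      intro z hzL hz
      rw [hS] at hz
      obtain ⟨a, ha, b, hb, rfl⟩ := mem_decomp' hz
      rw [← hS] at hb
      have h1 : L.mkQ b ∈ I k ^ (n+1) • (⊤ : Submodule R (N ⧸ L)) := by
        apply hcol
        have h2 : f k • L.mkQ b = - L.mkQ a := by
          rw [← map_smul, ← map_neg, ← sub_eq_zero, ← map_sub]
          simp only [Submodule.mkQ_apply, Submodule.Quotient.mk_eq_zero]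
          convert hzL using 1; abel
        rw [h2, ← hmap]
        exact neg_mem (Submodule.mem_map_of_mem ha)
      rw [← hmap] at h1
      obtain ⟨b', hb', hbb⟩ := h1
      have hl : b - b' ∈ L := by
        rw [← Submodule.Quotient.mk_eq_zero, ← Submodule.mkQ_apply, map_sub, hbb, sub_self]
      have hl2 : b - b' ∈ I (k+1) ^ n • L := by
        refine ihn _ hl (sub_mem hb ?_)
        exact Submodule.smul_mono_left
          ((Ideal.pow_right_mono hIk _).trans (Ideal.pow_le_pow_right (by omega))) hb'
      have h3 : a + f k • b' ∈ I k ^ (n+1) • L := by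
        apply ihk (by omega)
        · have : a + f k • b' = (a + f k • b) - f k • (b - b') := by rw [smul_sub]; abel
          rw [this]; exact sub_mem hzL (Submodule.smul_mem _ _ hl)
        · exact add_mem ha (Submodule.smul_mem _ _ hb')
      have : a + f k • b = (a + f k • b') + f k • (b - b') := by rw [smul_sub]; abel
      rw [this]
      refine add_mem (Submodule.smul_mono_left (Ideal.pow_right_mono hIk _) h3) ?_
      rw [pow_succ', mul_smul]
      exact Submodule.smul_mem_smul hfk hl2

end SeqCM

namespace SeqCM
open Pointwise RingTheory.Sequence

section
variable {R : Type*} [CommRing R] [IsLocalRing R] [IsNoetherianRing R]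

/-- only the closed point of the support contains the sequence -/
def Par (R : Type*) [CommRing R] [IsLocalRing R] (C : Type*) [AddCommGroup C] [Module R C]
    (xs : List R) : Prop :=
  ∀ p : PrimeSpectrum R, p ∈ Module.support R C → (∀ r ∈ xs, r ∈ p.asIdeal) →
    maximalIdeal R ≤ p.asIdeal

lemma support_quotSMulTop_sub {C : Type*} [AddCommGroup C] [Module R C] [Module.Finite R C]
    (x : R) {p : PrimeSpectrum R} (hp : p ∈ Module.support R (QuotSMulTop x C)) :
    p ∈ Module.support R C ∧ x ∈ p.asIdeal := by
  rw [Module.support_quotSMulTop] at hp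
  simpa using hp

lemma Par.tail {C : Type*} [AddCommGroup C] [Module R C] [Module.Finite R C] {x : R} {xs : List R}
    (h : Par R C (x :: xs)) : Par R (QuotSMulTop x C) xs := by
  intro p hp hxs
  obtain ⟨h1, h2⟩ := support_quotSMulTop_sub x hp
  refine h p h1 ?_
  simp only [List.mem_cons, forall_eq_or_imp]
  exact ⟨h2, hxs⟩

lemma supportDim_le_of_par (xs : List R) (hxs : ∀ r ∈ xs, r ∈ maximalIdeal R) :
    ∀ {C : Type*} [AddCommGroup C] [Module R C] [Module.Finite R C], Par R C xs →
      Module.supportDim R C ≤ xs.length := by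
  induction xs with
  | nil =>
    intro C _ _ _ h
    have : Subsingleton (Module.support R C) := by
      refine ⟨fun p q => ?_⟩
      have e : ∀ p : Module.support R C, p.1.asIdeal = maximalIdeal R := fun p =>
        le_antisymm (IsLocalRing.le_maximalIdeal p.1.2.ne_top) (h p.1 p.2 (by simp))
      apply Subtype.ext
      apply PrimeSpectrum.ext
      rw [e, e]
    have h0 : Order.krullDim (Module.support R C) ≤ 0 := Order.krullDim_nonpos_of_subsingleton
    simpa [Module.supportDim] using h0
  | cons x xs ih =>
    intro C _ _ _ h
    simp only [List.mem_cons, forall_eq_or_imp] at hxs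
    refine (Module.supportDim_le_supportDim_quotSMulTop_succ hxs.1).trans ?_
    have := ih hxs.2 h.tail
    simp only [List.length_cons]
    push_cast
    gcongr

lemma le_supportDim_of_ass (rs : List R) (hrs : ∀ r ∈ rs, r ∈ maximalIdeal R) :
    ∀ {C : Type*} [AddCommGroup C] [Module R C] [Module.Finite R C], IsWeaklyRegular C rs →
      ∀ p ∈ associatedPrimes R C, (rs.length : WithBot ℕ∞) ≤ Module.supportDim R (R ⧸ p) := by
  induction rs with
  | nil =>
    intro C _ _ _ h p hp
    have : Nontrivial (R ⧸ p) := Ideal.Quotient.nontrivial_iff.2 hp.1.ne_top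
    have h2 := Module.supportDim_ne_bot_of_nontrivial R (R ⧸ p)
    obtain ⟨n, hn⟩ := WithBot.ne_bot_iff_exists.1 h2
    rw [← hn]
    simp
  | cons y rs ih =>
    intro C _ _ _ h p hp
    simp only [List.mem_cons, forall_eq_or_imp] at hrs
    rw [isWeaklyRegular_cons_iff] at h
    obtain ⟨hy, hrest⟩ := h
    have hpp := hp.1
    -- submodule killed by p
    set N : Submodule R C := Submodule.torsionBySet R C (p : Set R) with hN
    have hNmem : ∀ c, c ∈ N ↔ ∀ a ∈ p, a • c = 0 := by
      intro c; rw [hN, Submodule.mem_torsionBySet_iff]; simp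
    obtain ⟨-, c, hc⟩ := isAssociatedPrime_iff.1 hp
    have hcN : c ∈ N := by
      rw [hNmem]; intro a ha; rw [hc] at ha
      simpa [Submodule.mem_colon_singleton] using ha
    have hc0 : c ≠ 0 := by
      rintro rfl
      apply hpp.ne_top
      rw [hc, Ideal.eq_top_iff_one]
      simp [Submodule.mem_colon_singleton]
    have hyp : y ∉ p := by
      intro hyp
      have := (hNmem c).1 hcN y hyp
      exact hc0 (hy (by simpa using this))
    have hex : ∃ u ∈ N, u ∉ y • (⊤ : Submodule R C) := by
      by_contra! hcon
      have : N ≤ maximalIdeal R • N := by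
        intro u hu
        obtain ⟨v, -, rfl⟩ := (Submodule.mem_smul_pointwise_iff_exists _ _ _).1 (hcon u hu)
        apply Submodule.smul_mem_smul hrs.1
        rw [hNmem] at hu ⊢
        intro a ha
        apply hy
        have := hu a ha
        rw [smul_comm] at this
        simpa using this
      have hbot := Submodule.eq_bot_of_le_smul_of_le_jacobson_bot (maximalIdeal R) N
        (IsNoetherian.noetherian N) this (IsLocalRing.maximalIdeal_le_jacobson _)
      rw [hbot] at hcN
      exact hc0 (by simpa using hcN)
    obtain ⟨u, huN, huy⟩ := hex
    have hu0 : (Submodule.mkQ (y • (⊤ : Submodule R C)) u : QuotSMulTop y C) ≠ 0 := by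
      intro h0
      exact huy ((Submodule.Quotient.mk_eq_zero _).1 h0)
    obtain ⟨P, hP, hle⟩ := exists_le_isAssociatedPrime_of_isNoetherianRing R
      (Submodule.mkQ (y • (⊤ : Submodule R C)) u : QuotSMulTop y C) hu0
    have hpP : p ≤ P := by
      intro a ha
      apply hle
      rw [Submodule.mem_colon_singleton, ← map_smul, (hNmem u).1 huN a ha, map_zero]
      exact zero_mem _
    have hyP : y ∈ P := by
      apply hle
      rw [Submodule.mem_colon_singleton, ← map_smul]
      simp only [Submodule.mem_bot]
      exact (Submodule.Quotient.mk_eq_zero _).2 (Submodule.smul_mem_pointwise_smul _ _ _ trivial)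
    have h1 := ih hrs.2 hrest P hP
    have hreg : IsSMulRegular (R ⧸ p) y := by
      rw [isSMulRegular_iff_right_eq_zero_of_smul]
      intro z hz
      obtain ⟨z, rfl⟩ := Ideal.Quotient.mk_surjective z
      have : Ideal.Quotient.mk p (y * z) = 0 := hz
      rw [Ideal.Quotient.eq_zero_iff_mem] at this ⊢
      exact (hpp.mem_or_mem this).resolve_left hyp
    have h2 := Module.supportDim_quotSMulTop_succ_eq_supportDim hreg hrs.1
    rw [← h2]
    simp only [List.length_cons]
    push_cast
    gcongr
    refine h1.trans ?_
    let g : QuotSMulTop y (R ⧸ p) →ₗ[R] R ⧸ P :=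
      Submodule.liftQ _ (Submodule.factor hpP) (by
        intro z hz
        obtain ⟨v, -, rfl⟩ := (Submodule.mem_smul_pointwise_iff_exists _ _ _).1 hz
        obtain ⟨v, rfl⟩ := Ideal.Quotient.mk_surjective v
        rw [LinearMap.mem_ker, map_smul]
        change Ideal.Quotient.mk P (y * v) = 0
        rw [Ideal.Quotient.eq_zero_iff_mem]
        exact Ideal.mul_mem_right _ _ hyP)
    apply Module.supportDim_le_of_surjective g
    intro z
    obtain ⟨z, rfl⟩ := Ideal.Quotient.mk_surjective z
    exact ⟨Submodule.mkQ _ (Ideal.Quotient.mk p z), rfl⟩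

end

section
universe u v
variable {R : Type u} [CommRing R] [IsLocalRing R] [IsNoetherianRing R]

open CategoryTheory Abelian in
lemma depth_quot [Small.{v} R] (C : Type v) [AddCommGroup C] [Module R C] [Module.Finite R C]
    (n : ℕ) (h : ∃ rs : List R, rs.length = n + 1 ∧ (∀ r ∈ rs, r ∈ maximalIdeal R) ∧ IsRegular C rs)
    (x : R) (hx : x ∈ maximalIdeal R) (hreg : IsSMulRegular C x) :
    ∃ rs : List R, rs.length = n ∧ (∀ r ∈ rs, r ∈ maximalIdeal R) ∧
      IsRegular (QuotSMulTop x C) rs := by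
  have hnt : Nontrivial C := h.choose_spec.2.2.nontrivial
  have hnt2 := nontrivial_quotSMulTop_of_mem_maximalIdeal C hx
  have hlt : ∀ (W : Type v) [AddCommGroup W] [Module R W] [Module.Finite R W] [Nontrivial W],
      maximalIdeal R • (⊤ : Submodule R W) < ⊤ := fun W _ _ _ _ =>
    (Submodule.top_ne_ideal_smul_of_le_jacobson_annihilator
      (maximalIdeal_le_jacobson _)).symm.lt_top
  have h1 := ((ModuleCat.exists_isRegular_tfae (maximalIdeal R) (n+1) (ModuleCat.of R C)
    (hlt C)).out 3 1).1 h
  refine ((ModuleCat.exists_isRegular_tfae (maximalIdeal R) n (ModuleCat.of R (QuotSMulTop x C))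
    (hlt _)).out 1 3).1 ?_
  intro i hi
  have zero1 := AddCommGrpCat.isZero_of_iff_subsingleton.mpr (h1 i (by omega))
  have zero2 := AddCommGrpCat.isZero_of_iff_subsingleton.mpr (h1 (i + 1) (by omega))
  have hreg' : IsSMulRegular (ModuleCat.of R C) x := hreg
  exact AddCommGrpCat.subsingleton_of_isZero <| ShortComplex.Exact.isZero_of_both_zeros
    ((Ext.covariant_sequence_exact₃' _ hreg'.smulShortComplex_shortExact) i (i + 1) rfl)
    (zero1.eq_zero_of_src _) (zero2.eq_zero_of_tgt _)

lemma par_regular_small [Small.{v} R] (xs : List R) (hxs : ∀ r ∈ xs, r ∈ maximalIdeal R) :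
    ∀ (C : Type v) [AddCommGroup C] [Module R C] [Module.Finite R C],
    (∃ rs : List R, rs.length = xs.length ∧ (∀ r ∈ rs, r ∈ maximalIdeal R) ∧ IsRegular C rs) →
    Par R C xs → IsWeaklyRegular C xs := by
  induction xs with
  | nil => intro C _ _ _ _ _; simp
  | cons x xs ih =>
    intro C _ _ _ h hp
    simp only [List.mem_cons, forall_eq_or_imp] at hxs
    have hreg : IsSMulRegular C x := by
      have hc := biUnion_associatedPrimes_eq_compl_regular R C
      by_contra hnot
      have : x ∈ ⋃ p ∈ associatedPrimes R C, (p : Set R) := by rw [hc]; exact hnot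
      simp only [Set.mem_iUnion, exists_prop] at this
      obtain ⟨p, hpA, hxp⟩ := this
      obtain ⟨rs, hl, hm, hr⟩ := h
      have h1 := le_supportDim_of_ass rs hm hr.toIsWeaklyRegular p hpA
      have h2 : Module.supportDim R (R ⧸ p) ≤ xs.length := by
        apply supportDim_le_of_par xs hxs.2
        intro P hP hxP
        rw [Module.mem_support_iff_of_finite, Ideal.annihilator_quotient] at hP
        refine hp P ?_ ?_
        · rw [Module.mem_support_iff_of_finite]
          refine le_trans ?_ hP
          rw [← Submodule.annihilator_top]
          exact hpA.annihilator_le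
        · simp only [List.mem_cons, forall_eq_or_imp]
          exact ⟨hP hxp, hxP⟩
      have h3 := h1.trans h2
      rw [hl, List.length_cons] at h3
      have : xs.length + 1 ≤ xs.length := by exact_mod_cast h3
      omega
    rw [isWeaklyRegular_cons_iff]
    refine ⟨hreg, ih hxs.2 _ ?_ hp.tail⟩
    exact depth_quot C _ (by simpa using h) x hxs.1 hreg

lemma par_regular (xs : List R) (hxs : ∀ r ∈ xs, r ∈ maximalIdeal R)
    (C : Type v) [AddCommGroup C] [Module R C] [Module.Finite R C]
    (h : ∃ rs : List R, rs.length = xs.length ∧ (∀ r ∈ rs, r ∈ maximalIdeal R) ∧ IsRegular C rs)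
    (hp : Par R C xs) : IsWeaklyRegular C xs := by
  let e : ULift.{u} C ≃ₗ[R] C := ULift.moduleEquiv
  rw [← e.isWeaklyRegular_congr]
  apply par_regular_small.{u, max u v} xs hxs
  · obtain ⟨rs, h1, h2, h3⟩ := h
    exact ⟨rs, h1, h2, (e.isRegular_congr rs).2 h3⟩
  · intro p hp'
    rw [e.support_eq] at hp'
    exact hp p hp'

end
end SeqCM

namespace SeqCM
open RingTheory.Sequence

lemma moduleDim_eq (R M : Type*) [CommRing R] [AddCommGroup M] [Module R M] [Module.Finite R M] :
    moduleDim R M = Module.supportDim R M :=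
  (Module.supportDim_eq_ringKrullDim_quotient_annihilator R M).symm

lemma exists_rs {R C : Type*} [CommRing R] [IsLocalRing R] [AddCommGroup C] [Module R C]
    [Module.Finite R C] [Nontrivial C] (s : ℕ) (h : (s : ℕ∞) ≤ moduleDepth R C) :
    ∃ rs : List R, rs.length = s ∧ (∀ r ∈ rs, r ∈ maximalIdeal R) ∧ IsRegular C rs := by
  cases s with
  | zero => exact ⟨[], rfl, by simp, IsRegular.nil R C⟩
  | succ s =>
    have h1 : (s : ℕ∞) < moduleDepth R C := lt_of_lt_of_le (by exact_mod_cast Nat.lt_succ_self s) h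
    obtain ⟨n, ⟨rs, rfl, hm, hr⟩, hn⟩ := lt_sSup_iff.1 h1
    have hlen : s < rs.length := by exact_mod_cast hn
    have hm' : ∀ r ∈ rs.take (s+1), r ∈ maximalIdeal R := fun r hr => hm r (List.mem_of_mem_take hr)
    refine ⟨rs.take (s+1), by simp; omega, hm', ?_⟩
    apply IsRegular.of_isWeaklyRegular_of_mem_maximalIdeal C hm'
    have := hr.toIsWeaklyRegular
    rw [← List.take_append_drop (s+1) rs, isWeaklyRegular_append_iff] at this
    exact this.1

lemma supportDim_le_max {R N : Type*} [CommRing R] [AddCommGroup N] [Module R N]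
    (L : Submodule R N) :
    Module.supportDim R N ≤ max (Module.supportDim R L) (Module.supportDim R (N ⧸ L)) := by
  have key : ∀ (W : Type _) [AddCommGroup W] [Module R W] (p : LTSeries (Module.support R N)),
      p.head.1 ∈ Module.support R W → (p.length : WithBot ℕ∞) ≤ Module.supportDim R W := by
    intro W _ _ p hp
    let q : LTSeries (Module.support R W) :=
      { length := p.length
        toFun := fun i => ⟨(p i).1, Module.mem_support_mono (p.monotone (Fin.zero_le i)) hp⟩
        step := fun i => p.step i }
    exact Order.LTSeries.length_le_krullDim q
  refine iSup_le fun p => ?_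
  have hs := Module.support_of_exact (f := L.subtype) (g := L.mkQ) (R := R)
    (LinearMap.exact_subtype_mkQ L) L.injective_subtype L.mkQ_surjective
  have hp : p.head.1 ∈ Module.support R L ∪ Module.support R (N ⧸ L) := hs ▸ p.head.2
  rcases hp with hp | hp
  · exact le_max_of_le_left (key _ p hp)
  · exact le_max_of_le_right (key _ p hp)

lemma pow_le_annihilator {R W : Type*} [CommRing R] [IsLocalRing R] [AddCommGroup W] [Module R W]
    (h : IsFiniteLength R W) : ∃ k : ℕ, maximalIdeal R ^ k ≤ Module.annihilator R W := by
  obtain ⟨h1, h2⟩ := isFiniteLength_iff_isNoetherian_isArtinian.1 h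
  let g : ℕ →o (Submodule R W)ᵒᵈ :=
    { toFun := fun k => OrderDual.toDual (maximalIdeal R ^ k • (⊤ : Submodule R W))
      monotone' := fun a b hab => Submodule.smul_mono_left (Ideal.pow_le_pow_right hab) }
  obtain ⟨k, hk⟩ := IsArtinian.monotone_stabilizes g
  have h3 : maximalIdeal R ^ k • (⊤ : Submodule R W) = maximalIdeal R ^ (k+1) • (⊤ : Submodule R W) :=
    hk (k+1) (by omega)
  have hbot := Submodule.eq_bot_of_le_smul_of_le_jacobson_bot (maximalIdeal R)
    (maximalIdeal R ^ k • (⊤ : Submodule R W)) (IsNoetherian.noetherian _)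
    (by rw [← mul_smul, ← pow_succ', ← h3]) (IsLocalRing.maximalIdeal_le_jacobson _)
  refine ⟨k, ?_⟩
  intro r hr
  rw [Module.mem_annihilator]
  intro w
  have : r • w ∈ maximalIdeal R ^ k • (⊤ : Submodule R W) := Submodule.smul_mem_smul hr trivial
  rw [hbot] at this
  simpa using this

lemma ofList_take {R : Type*} [CommRing R] (f : ℕ → R) (s k : ℕ) (hk : k ≤ s) :
    Ideal.ofList (((List.range s).map f).take k) = Ideal.span (f '' {j | j < k}) := by
  rw [Ideal.ofList]
  congr 1
  ext r
  rw [← List.map_take, List.take_range, min_eq_left hk]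
  simp

/-- one step of the filtration -/
lemma step {R : Type*} [CommRing R] [IsLocalRing R] [IsNoetherianRing R]
    {M : Type*} [AddCommGroup M] [Module R M] [Module.Finite R M]
    {d : ℕ} (x : Fin d → R) (hx : IsSOP R M x) (L N : Submodule R M) (hLN : L ≤ N) (s : ℕ)
    (hkill : ∀ j : Fin d, s ≤ (j : ℕ) → ∀ m ∈ N, x j • m = 0)
    (hdim : moduleDim R N = s) (hlt : moduleDim R L < moduleDim R N)
    (hCM : IsCM R (N ⧸ L.comap N.subtype)) (n : ℕ) :
    (Ideal.span (Set.range x)) ^ n • N ⊓ L ≤ (Ideal.span (Set.range x)) ^ n • L := by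
  set q := Ideal.span (Set.range x) with hq
  let f : ℕ → R := fun k => if h : k < d then x ⟨k, h⟩ else 0
  have hfx : ∀ j : Fin d, f j = x j := fun j => by simp [f]
  have hfq : ∀ k, f k ∈ q := by
    intro k
    by_cases h : k < d
    · simp only [f, h, dif_pos]; exact Ideal.subset_span ⟨_, rfl⟩
    · simp only [f, h, dif_neg, not_false_eq_true]; exact zero_mem _
  have hfm : ∀ k, f k ∈ maximalIdeal R := by
    intro k
    by_cases h : k < d
    · simp only [f, h, dif_pos]; exact hx.1 _
    · simp only [f, h, dif_neg, not_false_eq_true]; exact zero_mem _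
  let I : ℕ → Ideal R := fun k => Ideal.span (f '' {j | j < k})
  have h0 : I 0 = ⊥ := by simp [I]
  have hS : ∀ k, I (k+1) = I k ⊔ Ideal.span {f k} := by
    intro k
    simp only [I]
    rw [← Ideal.span_union]
    congr 1
    ext r
    simp only [Set.mem_image, Set.mem_setOf_eq, Set.union_singleton, Set.mem_insert_iff,
      Nat.lt_succ_iff_lt_or_eq]
    constructor
    · rintro ⟨j, hj | rfl, rfl⟩
      · exact Or.inr ⟨j, hj, rfl⟩
      · exact Or.inl rfl
    · rintro (rfl | ⟨j, hj, rfl⟩)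
      · exact ⟨k, Or.inr rfl, rfl⟩
      · exact ⟨j, Or.inl hj, rfl⟩
  have hIq : I s ≤ q := by
    apply Ideal.span_le.2
    rintro _ ⟨j, -, rfl⟩
    exact hfq j
  set L' : Submodule R N := L.comap N.subtype with hL'
  let C := N ⧸ L'
  -- dimension
  have hdC : (s : WithBot ℕ∞) ≤ Module.supportDim R C := by
    have h1 := supportDim_le_max (R := R) L'
    have e : L' ≃ₗ[R] L := Submodule.comapSubtypeEquivOfLe hLN
    rw [Module.supportDim_eq_of_equiv e, ← moduleDim_eq, ← moduleDim_eq, hdim] at h1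
    rw [hdim] at hlt
    rcases le_max_iff.1 h1 with h | h
    · exact absurd hlt (not_lt.2 h)
    · exact h
  have hntC : Nontrivial C := by
    by_contra hn
    rw [not_nontrivial_iff_subsingleton] at hn
    rw [Module.supportDim_eq_bot_of_subsingleton] at hdC
    simp at hdC
  have hdepth : (s : ℕ∞) ≤ moduleDepth R C := by
    have h1 : (moduleDepth R C : WithBot ℕ∞) = moduleDim R C := hCM
    rw [moduleDim_eq] at h1
    rw [← h1] at hdC
    exact_mod_cast hdC
  let xs : List R := (List.range s).map f
  have hxsm : ∀ r ∈ xs, r ∈ maximalIdeal R := by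
    intro r hr
    obtain ⟨j, -, rfl⟩ := List.mem_map.1 hr
    exact hfm j
  have hpar : Par R C xs := by
    intro p hp hpx
    rw [Module.mem_support_iff_of_finite] at hp
    have hMC : Module.annihilator R M ≤ Module.annihilator R C :=
      (LinearMap.annihilator_le_of_injective N.subtype N.injective_subtype).trans
        (LinearMap.annihilator_le_of_surjective L'.mkQ L'.mkQ_surjective)
    have hxp : ∀ j, x j ∈ p.asIdeal := by
      intro j
      by_cases hj : (j : ℕ) < s
      · apply hpx
        exact List.mem_map.2 ⟨j, by simpa using hj, hfx j⟩
      · apply hp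
        rw [Module.mem_annihilator]
        intro c
        obtain ⟨c, rfl⟩ := L'.mkQ_surjective c
        rw [← map_smul]
        have : x j • c = 0 := Subtype.ext (hkill j (by omega) c.1 c.2)
        rw [this, map_zero]
    have hsupp : p ∈ Module.support R (M ⧸ (q • (⊤ : Submodule R M))) := by
      rw [Module.support_quotient]
      refine ⟨?_, ?_⟩
      · rw [Module.mem_support_iff_of_finite]; exact hMC.trans hp
      · rw [PrimeSpectrum.mem_zeroLocus, SetLike.coe_subset_coe, hq, Ideal.span_le]
        rintro _ ⟨j, rfl⟩
        exact hxp j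
    rw [Module.mem_support_iff_of_finite] at hsupp
    obtain ⟨k, hk⟩ := pow_le_annihilator hx.2
    exact p.2.le_of_pow_le (hk.trans hsupp)
  have hwr := par_regular xs hxsm C
    (by simpa [xs] using exists_rs (R := R) (C := C) s hdepth) hpar
  have reg : ∀ k < s, ∀ c : C, f k • c ∈ I k • (⊤ : Submodule R C) →
      c ∈ I k • (⊤ : Submodule R C) := by
    intro k hk c hc
    have h1 := hwr.regular_mod_prev k (by simpa [xs] using hk)
    have h2 : Ideal.ofList (xs.take k) = I k := ofList_take f s k hk.le
    have h3 : xs[k]'(by simpa [xs] using hk) = f k := by simp [xs]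
    rw [h3, h2] at h1
    exact mem_of_isSMulRegular_quotient_of_smul_mem h1 hc
  have main := inter_pow L' f I h0 hS s reg s le_rfl n
  -- q^n N = I_s^n N
  have hqN1 : q • N ≤ I s • N := by
    rw [Submodule.smul_le]
    intro r hr m hm
    induction hr using Submodule.span_induction with
    | mem r hr =>
      obtain ⟨j, rfl⟩ := hr
      by_cases hj : (j : ℕ) < s
      · apply Submodule.smul_mem_smul _ hm
        rw [← hfx]
        exact Ideal.subset_span ⟨j, hj, rfl⟩
      · rw [hkill j (by omega) m hm]; exact zero_mem _
    | zero => simp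
    | add a b _ _ ha hb => rw [add_smul]; exact add_mem ha hb
    | smul a b _ hb => rw [smul_assoc]; exact Submodule.smul_mem _ _ hb
  have hqN : ∀ n : ℕ, q ^ n • N ≤ I s ^ n • N := by
    intro n
    induction n with
    | zero => simp
    | succ n ih =>
      calc q ^ (n+1) • N = q • (q ^ n • N) := by rw [pow_succ', mul_smul]
        _ ≤ q • (I s ^ n • N) := Submodule.smul_mono le_rfl ih
        _ = I s ^ n • (q • N) := by rw [← mul_smul, mul_comm, mul_smul]
        _ ≤ I s ^ n • (I s • N) := Submodule.smul_mono le_rfl hqN1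
        _ = I s ^ (n+1) • N := by rw [← mul_smul, pow_succ]
  rintro z ⟨hz1, hz2⟩
  have hz3 := hqN n hz1
  have hz4 : z ∈ (I s ^ n • (⊤ : Submodule R N)).map N.subtype := by
    rw [Submodule.map_smul'', Submodule.map_top, Submodule.range_subtype]; exact hz3
  obtain ⟨z', hz', rfl⟩ := hz4
  have hz5 := main z' hz2 hz'
  have hz6 : N.subtype z' ∈ (I s ^ n • L').map N.subtype := Submodule.mem_map_of_mem hz5
  rw [Submodule.map_smul''] at hz6
  refine Submodule.smul_mono (Ideal.pow_right_mono hIq n) ?_ hz6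
  exact Submodule.map_comap_le _ _

end SeqCM

/-- **Lemma 4.1.** If `M` is sequentially Cohen-Macaulay and `q` is a good parameter
ideal of `M`, then `q^n M ∩ D_i = q^n D_i` for all `n ≥ 1` and all `i`. -/
theorem stmt_17 {R : Type*} [CommRing R] [IsLocalRing R] [IsNoetherianRing R]
    {M : Type*} [AddCommGroup M] [Module R M] [Module.Finite R M]
    {d t : ℕ} (hd : moduleDim R M = (d : WithBot ℕ∞))
    (D : Fin (t + 1) → Submodule R M) (hD : IsDimFiltration R M D)
    (ds : Fin (t + 1) → ℕ)
    (hds : ∀ i, (D i = ⊥ ∧ ds i = 0) ∨ moduleDim R ↥(D i) = (ds i : WithBot ℕ∞))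
    (hseqCM : ∀ i : Fin t, IsCM R (↥(D i.succ) ⧸ (D i.castSucc).comap (D i.succ).subtype))
    (x : Fin d → R) (hx : IsGoodSOP R M D ds x) :
    ∀ n : ℕ, 1 ≤ n → ∀ i : Fin (t + 1),
      (Ideal.span (Set.range x)) ^ n • (⊤ : Submodule R M) ⊓ D i =
        (Ideal.span (Set.range x)) ^ n • D i := by
  intro n hn i
  obtain ⟨hsop, hgood⟩ := hx
  obtain ⟨-, hDt, hDi⟩ := hD
  apply le_antisymm
  · induction i using Fin.reverseInduction with
    | last => rw [hDt]; simp
    | cast i ih =>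
      obtain ⟨hle, hlt, -⟩ := hDi i
      have hdim : moduleDim R ↥(D i.succ) = (ds i.succ : WithBot ℕ∞) := by
        rcases hds i.succ with ⟨hb, -⟩ | h
        · exfalso
          rw [hb, SeqCM.moduleDim_eq R (⊥ : Submodule R M),
            Module.supportDim_eq_bot_of_subsingleton] at hlt
          exact not_lt_bot hlt
        · exact h
      refine le_trans (le_inf (le_trans ?_ ih) inf_le_right)
        (SeqCM.step x hsop (D i.castSucc) (D i.succ) hle (ds i.succ) ?_ hdim hlt (hseqCM i) n)
      · exact inf_le_inf_left _ hle
      · intro j hj m hm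
        by_cases hit : (i.succ : ℕ) < t
        · have hb := hgood i.succ hit
          have : x j • m ∈ (⊥ : Submodule R M) := by
            rw [← hb]
            exact ⟨Submodule.smul_mem _ _ hm,
              Submodule.smul_mem_smul (Ideal.subset_span ⟨j, hj, rfl⟩) trivial⟩
          simpa using this
        · exfalso
          have hlast : i.succ = Fin.last t := by
            apply Fin.ext; simp only [Fin.val_last]; have := i.succ.2; omega
          rw [hlast, hDt, SeqCM.moduleDim_eq,
            Module.supportDim_eq_of_equiv Submodule.topEquiv, ← SeqCM.moduleDim_eq, hd,
            ← hlast] at hdim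
          have h1 : d = ds i.succ := by exact_mod_cast hdim
          have := j.2
          omega
  · exact le_inf (Submodule.smul_mono le_rfl le_top) Submodule.smul_le_right
end

section
/- Let (R, 𝔪) be a commutative Noetherian local ring, M a finitely generated R-module of dimension d, and q a parameter ideal of M. Then ℓ(M/q^{n+1}M) ≤ C(n+d, d)·ℓ(M/qM) for all n ≥ 0, where ℓ denotes length and C(n+d, d) is the binomial coefficient. Moreover, this inequality is an equality for all n ≥ 0 if and only if M is a Cohen-Macaulay module. -/
open IsLocalRing

section helpers
open RingTheory.Sequence Pointwise
variable {R : Type*} [CommRing R]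

lemma sup_pow_succ_le (I J : Ideal R) (n : ℕ) :
    (I ⊔ J) ^ (n + 1) ≤ I * (I ⊔ J) ^ n ⊔ J ^ (n + 1) := by
  induction n with
  | zero => simp
  | succ n ih =>
    rw [pow_succ', Ideal.sup_mul]
    refine sup_le le_sup_left ?_
    refine (Ideal.mul_mono_right ih).trans ?_
    rw [Ideal.mul_sup, ← pow_succ']
    refine sup_le_sup ?_ le_rfl
    rw [mul_left_comm]
    refine Ideal.mul_mono_right ?_
    rw [pow_succ']
    exact Ideal.mul_mono_left le_sup_right

lemma sup_pow_le' (I J : Ideal R) (n : ℕ) : (I ⊔ J) ^ n ≤ J ^ n ⊔ I := by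
  cases n with
  | zero => simp
  | succ n =>
    refine (sup_pow_succ_le I J n).trans ?_
    refine sup_le ?_ le_sup_left
    exact fun x hx => Submodule.mem_sup_right (Ideal.mul_le_left hx)

lemma bot_pow_succ' (n : ℕ) : (⊥ : Ideal R) ^ (n + 1) = ⊥ := by
  rw [pow_succ, Ideal.mul_bot]

lemma enat_mul_ne_top {a : ℕ} {b : ℕ∞} (hb : b ≠ ⊤) : (a : ℕ∞) * b ≠ ⊤ := by
  lift b to ℕ using hb
  exact_mod_cast ENat.natCast_ne_top (a * b)

/-- multiplication by `a` from `M/q^n M` to `M/q^{n+1}M`. -/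
noncomputable def mulMap (M : Type*) [AddCommGroup M] [Module R M] (a : R) (rs : List R) (n : ℕ) :
    (M ⧸ (Ideal.ofList (a :: rs) ^ n • (⊤ : Submodule R M))) →ₗ[R]
    (M ⧸ (Ideal.ofList (a :: rs) ^ (n + 1) • (⊤ : Submodule R M))) :=
  Submodule.mapQ _ _ (LinearMap.lsmul R M a) (by
    rw [← Submodule.map_le_iff_le_comap, pow_succ', Submodule.mul_smul]
    rintro _ ⟨m, hm, rfl⟩
    refine Submodule.smul_mem_smul ?_ hm
    exact Ideal.subset_span (by simp))

lemma comap_aux (M : Type*) [AddCommGroup M] [Module R M] (a : R) (I : Ideal R) :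
    Submodule.comap (Submodule.mkQ (a • (⊤ : Submodule R M)))
      (I • (⊤ : Submodule R (QuotSMulTop a M))) = (I ⊔ Ideal.span {a}) • ⊤ := by
  rw [Submodule.comap_smul_top_of_surjective _ _ (Submodule.mkQ_surjective _), Submodule.ker_mkQ,
      ← Submodule.ideal_span_singleton_smul, ← Submodule.sup_smul]

/-- the projection `M/q^n M → M'/q'^n M'`, `M' = M/aM`. -/
noncomputable def projMap (M : Type*) [AddCommGroup M] [Module R M] (a : R) (rs : List R) (n : ℕ) :
    (M ⧸ (Ideal.ofList (a :: rs) ^ n • (⊤ : Submodule R M))) →ₗ[R]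
    (QuotSMulTop a M ⧸ (Ideal.ofList rs ^ n • (⊤ : Submodule R (QuotSMulTop a M)))) :=
  Submodule.mapQ _ _ (Submodule.mkQ _) (by
    rw [comap_aux, Ideal.ofList_cons]
    exact Submodule.smul_mono_left (sup_pow_le' _ _ _))

lemma projMap_surjective (M : Type*) [AddCommGroup M] [Module R M] (a : R) (rs : List R) (n : ℕ) :
    Function.Surjective (projMap M a rs n) := by
  intro y
  obtain ⟨y, rfl⟩ := Submodule.mkQ_surjective _ y
  obtain ⟨y, rfl⟩ := Submodule.mkQ_surjective _ y
  exact ⟨Submodule.mkQ _ y, rfl⟩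

lemma range_mulMap (M : Type*) [AddCommGroup M] [Module R M] (a : R) (rs : List R) (n : ℕ) :
    LinearMap.range (mulMap M a rs n) = LinearMap.ker (projMap M a rs (n + 1)) := by
  ext y
  obtain ⟨y, rfl⟩ := Submodule.mkQ_surjective _ y
  have h1 : Submodule.mkQ _ y ∈ LinearMap.ker (projMap M a rs (n + 1)) ↔
      y ∈ (Ideal.ofList rs ^ (n + 1) ⊔ Ideal.span {a}) • (⊤ : Submodule R M) := by
    rw [← comap_aux, LinearMap.mem_ker]
    exact Submodule.Quotient.mk_eq_zero _
  rw [h1, Submodule.sup_smul, Submodule.ideal_span_singleton_smul]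
  constructor
  · rintro ⟨z, hz⟩
    obtain ⟨z, rfl⟩ := Submodule.mkQ_surjective _ z
    have hz' : Submodule.mkQ _ (a • z) = Submodule.mkQ _ y := hz
    have : a • z - y ∈ (Ideal.ofList (a :: rs) ^ (n + 1) • (⊤ : Submodule R M)) :=
      (Submodule.Quotient.eq _).mp hz'
    have h2 : a • z - y ∈ Ideal.ofList rs ^ (n + 1) • (⊤ : Submodule R M) ⊔ a • ⊤ := by
      rw [← Submodule.ideal_span_singleton_smul, ← Submodule.sup_smul]
      rw [Ideal.ofList_cons] at this
      exact Submodule.smul_mono_left (sup_pow_le' _ _ _) this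
    have h3 : a • z ∈ Ideal.ofList rs ^ (n + 1) • (⊤ : Submodule R M) ⊔ a • ⊤ :=
      Submodule.mem_sup_right (Submodule.smul_mem_pointwise_smul _ _ _ trivial)
    simpa using sub_mem h3 h2
  · intro hy
    obtain ⟨u, hu, v, hv, rfl⟩ := Submodule.mem_sup.mp hy
    obtain ⟨z, -, rfl⟩ := hv
    refine ⟨Submodule.mkQ _ z, ?_⟩
    change Submodule.mkQ _ (a • z) = Submodule.mkQ _ (u + a • z)
    refine (Submodule.Quotient.eq _).mpr ?_
    have h4 : u ∈ Ideal.ofList (a :: rs) ^ (n + 1) • (⊤ : Submodule R M) := by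
      refine Submodule.smul_mono_left (Ideal.pow_right_mono ?_ _) hu
      rw [Ideal.ofList_cons]; exact le_sup_right
    simpa using h4

lemma mulMap_injective_iff (M : Type*) [AddCommGroup M] [Module R M] (a : R) (rs : List R) (n : ℕ) :
    Function.Injective (mulMap M a rs n) ↔
      ∀ m : M, a • m ∈ Ideal.ofList (a :: rs) ^ (n + 1) • (⊤ : Submodule R M) →
        m ∈ Ideal.ofList (a :: rs) ^ n • (⊤ : Submodule R M) := by
  rw [injective_iff_map_eq_zero, (Submodule.mkQ_surjective _).forall]
  refine forall_congr' fun m => ?_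
  exact imp_congr (Submodule.Quotient.mk_eq_zero _) (Submodule.Quotient.mk_eq_zero _)

/-- length of `M/q^n M`. -/
noncomputable def LL (M : Type*) [AddCommGroup M] [Module R M] (rs : List R) (n : ℕ) : ℕ∞ :=
  Module.length R (M ⧸ (Ideal.ofList rs ^ n • (⊤ : Submodule R M)))

lemma LL_succ (M : Type*) [AddCommGroup M] [Module R M] (a : R) (rs : List R) (n : ℕ) :
    LL M (a :: rs) (n + 1) = Module.length R (LinearMap.range (mulMap M a rs n)) +
      LL (QuotSMulTop a M) rs (n + 1) := by
  refine Module.length_eq_add_of_exact (LinearMap.range (mulMap M a rs n)).subtype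
    (projMap M a rs (n + 1)) (Submodule.injective_subtype _) (projMap_surjective _ _ _ _) ?_
  rw [LinearMap.exact_iff, Submodule.range_subtype, range_mulMap]

lemma LL_range (M : Type*) [AddCommGroup M] [Module R M] (a : R) (rs : List R) (n : ℕ) :
    LL M (a :: rs) n = Module.length R (LinearMap.ker (mulMap M a rs n)) +
      Module.length R (LinearMap.range (mulMap M a rs n)) := by
  refine Module.length_eq_add_of_exact (LinearMap.ker (mulMap M a rs n)).subtype
    (mulMap M a rs n).rangeRestrict (Submodule.injective_subtype _)
      (LinearMap.surjective_rangeRestrict _) ?_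
  rw [LinearMap.exact_iff, Submodule.range_subtype, LinearMap.ker_rangeRestrict]

lemma LL_zero (M : Type*) [AddCommGroup M] [Module R M] (rs : List R) : LL M rs 0 = 0 := by
  rw [LL, Module.length_eq_zero_iff, Submodule.Quotient.subsingleton_iff]
  simp

lemma LL_one (M : Type*) [AddCommGroup M] [Module R M] (a : R) (rs : List R) :
    LL (QuotSMulTop a M) rs 1 = LL M (a :: rs) 1 := by
  have h1 := LL_succ M a rs 0
  have h2 := LL_range M a rs 0
  rw [LL_zero] at h2
  have := (add_eq_zero.mp h2.symm).2
  rw [this] at h1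
  rw [h1, zero_add, zero_add]

lemma LL_nil (M : Type*) [AddCommGroup M] [Module R M] (n : ℕ) :
    LL M ([] : List R) (n + 1) = LL M ([] : List R) 1 := by
  rw [LL, LL, Ideal.ofList_nil, bot_pow_succ', pow_one]

lemma choose_aux (n d : ℕ) (e : ℕ∞) : (((n + 1 + (d + 1)).choose (d + 1) : ℕ) : ℕ∞) * e =
    ((n + (d + 1)).choose (d + 1) : ℕ) * e + ((n + 1 + d).choose d : ℕ) * e := by
  rw [← add_mul, ← Nat.cast_add, ← add_assoc (n + 1) d 1, Nat.choose_succ_succ, add_comm,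
    show n + 1 + d = n + (d + 1) by ring]

lemma LL_le (rs : List R) : ∀ (M : Type*) [AddCommGroup M] [Module R M] (n : ℕ),
    LL M rs (n + 1) ≤ ((n + rs.length).choose rs.length : ℕ) * LL M rs 1 := by
  induction rs with
  | nil => intro M _ _ n; rw [LL_nil]; simp
  | cons a rs ih =>
    intro M _ _ n
    induction n with
    | zero => simp
    | succ n ihn =>
      rw [LL_succ, List.length_cons, choose_aux]
      refine add_le_add ?_ ?_
      · refine le_trans ?_ ihn
        rw [LL_range M a rs (n + 1)]
        exact le_add_self
      · rw [← LL_one]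
        exact ih _ _

end helpers

section loc
open RingTheory.Sequence Pointwise
variable {R : Type*} [CommRing R] [IsLocalRing R] [IsNoetherianRing R]

lemma mul_inj_of_reg {M : Type*} [AddCommGroup M] [Module R M] [Module.Finite R M] (a : R)
    (rs : List R)
    (hrs : IsWeaklyRegular M rs → ∀ c : R,
      IsSMulRegular (M ⧸ (Ideal.ofList rs • (⊤ : Submodule R M))) c → ∀ n : ℕ,
      IsSMulRegular (M ⧸ (Ideal.ofList rs ^ n • (⊤ : Submodule R M))) c)
    (hm : ∀ r ∈ a :: rs, r ∈ maximalIdeal R) (h : IsWeaklyRegular M (a :: rs)) (n : ℕ) :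
    Function.Injective (mulMap M a rs n) := by
  have h' : IsWeaklyRegular M (rs ++ [a]) :=
    IsLocalRing.isWeaklyRegular_of_perm_of_subset_maximalIdeal h
      (List.perm_append_singleton a rs).symm hm
  rw [isWeaklyRegular_append_iff, isWeaklyRegular_singleton_iff] at h'
  have hreg := hrs h'.1 a h'.2 (n + 1)
  rw [mulMap_injective_iff]
  intro m hmem
  have h2 : a • m ∈ (Ideal.span {a} * Ideal.ofList (a :: rs) ^ n ⊔ Ideal.ofList rs ^ (n + 1)) •
      (⊤ : Submodule R M) := by
    refine Submodule.smul_mono_left ?_ hmem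
    rw [Ideal.ofList_cons]
    exact sup_pow_succ_le _ _ _
  rw [Submodule.sup_smul, Submodule.mul_smul, Submodule.ideal_span_singleton_smul] at h2
  obtain ⟨u, ⟨z, hz, rfl⟩, v, hv, huv⟩ := Submodule.mem_sup.mp h2
  have h3 : a • (m - z) ∈ Ideal.ofList rs ^ (n + 1) • (⊤ : Submodule R M) := by
    rw [smul_sub, ← huv]
    simpa using hv
  have h4 := mem_of_isSMulRegular_quotient_of_smul_mem hreg h3
  have h5 : m - z ∈ Ideal.ofList (a :: rs) ^ n • (⊤ : Submodule R M) := by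
    refine Submodule.smul_mono_left ?_ h4
    refine (Ideal.pow_le_pow_right (Nat.le_succ n)).trans (Ideal.pow_right_mono ?_ _)
    rw [Ideal.ofList_cons]; exact le_sup_right
  simpa using add_mem h5 hz

lemma reg_pow (rs : List R) : ∀ (M : Type*) [AddCommGroup M] [Module R M] [Module.Finite R M],
    (∀ r ∈ rs, r ∈ maximalIdeal R) → IsWeaklyRegular M rs → ∀ c : R,
      IsSMulRegular (M ⧸ (Ideal.ofList rs • (⊤ : Submodule R M))) c → ∀ n : ℕ,
      IsSMulRegular (M ⧸ (Ideal.ofList rs ^ n • (⊤ : Submodule R M))) c := by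
  induction rs with
  | nil =>
    intro M _ _ _ hm h c hc n
    cases n with
    | zero =>
      rw [isSMulRegular_quotient_iff_mem_of_smul_mem]
      simp
    | succ n =>
      rw [isSMulRegular_quotient_iff_mem_of_smul_mem] at hc ⊢
      rw [Ideal.ofList_nil] at hc
      rwa [Ideal.ofList_nil, bot_pow_succ']
  | cons a rs ih =>
    intro M _ _ _ hm h c hc n
    have hm' : ∀ r ∈ rs, r ∈ maximalIdeal R := fun r hr => hm r (by simp [hr])
    induction n with
    | zero =>
      rw [isSMulRegular_quotient_iff_mem_of_smul_mem]
      simp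
    | succ n ihn =>
      refine isSMulRegular_of_range_eq_ker (mul_inj_of_reg a rs (ih M hm') hm h n)
        (range_mulMap M a rs n) ihn ?_
      refine ih (QuotSMulTop a M) hm' ((isWeaklyRegular_cons_iff M a rs).mp h).2 c ?_ _
      exact ((Submodule.quotOfListConsSMulTopEquivQuotSMulTopInner M a rs).isSMulRegular_congr c).mp hc

lemma LL_eq (rs : List R) : ∀ (M : Type*) [AddCommGroup M] [Module R M] [Module.Finite R M] (n : ℕ),
    (∀ r ∈ rs, r ∈ maximalIdeal R) → IsWeaklyRegular M rs →
    LL M rs (n + 1) = ((n + rs.length).choose rs.length : ℕ) * LL M rs 1 := by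
  induction rs with
  | nil => intro M _ _ _ n _ _; rw [LL_nil]; simp
  | cons a rs ih =>
    intro M _ _ _ n hm h
    have hm' : ∀ r ∈ rs, r ∈ maximalIdeal R := fun r hr => hm r (by simp [hr])
    induction n with
    | zero => simp
    | succ n ihn =>
      rw [LL_succ, List.length_cons, choose_aux]
      have hinj := mul_inj_of_reg a rs (reg_pow rs M hm') hm h (n + 1)
      have h1 := LL_range M a rs (n + 1)
      rw [LinearMap.ker_eq_bot.mpr hinj, Module.length_bot, zero_add] at h1
      rw [← h1, ihn, List.length_cons, ← LL_one,
        ih _ (n + 1) hm' ((isWeaklyRegular_cons_iff M a rs).mp h).2]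

lemma enat_aux {a b c d : ℕ∞} (h : a + b = c + d) (h1 : a ≤ c) (h2 : b ≤ d) (hc : c ≠ ⊤)
    (hd : d ≠ ⊤) : a = c ∧ b = d := by
  have ha : a ≠ ⊤ := ne_top_of_le_ne_top hc h1
  have hb : b ≠ ⊤ := ne_top_of_le_ne_top hd h2
  lift a to ℕ using ha
  lift b to ℕ using hb
  lift c to ℕ using hc
  lift d to ℕ using hd
  norm_cast at *
  omega

lemma reg_of_LL_eq (rs : List R) : ∀ (M : Type*) [AddCommGroup M] [Module R M] [Module.Finite R M],
    (∀ r ∈ rs, r ∈ maximalIdeal R) → LL M rs 1 ≠ ⊤ →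
    (∀ n : ℕ, LL M rs (n + 1) = ((n + rs.length).choose rs.length : ℕ) * LL M rs 1) →
    IsWeaklyRegular M rs := by
  induction rs with
  | nil => intro M _ _ _ _ _ _; exact .nil R M
  | cons a rs ih =>
    intro M _ _ _ hm hfin h
    have hm' : ∀ r ∈ rs, r ∈ maximalIdeal R := fun r hr => hm r (by simp [hr])
    have key : ∀ n, Module.length R (LinearMap.range (mulMap M a rs (n + 1))) =
        LL M (a :: rs) (n + 1) ∧ LL (QuotSMulTop a M) rs (n + 1 + 1) =
        ((n + 1 + rs.length).choose rs.length : ℕ) * LL M (a :: rs) 1 := by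
      intro n
      have h1 := h (n + 1)
      rw [LL_succ, List.length_cons, choose_aux] at h1
      have h2 := h n
      rw [List.length_cons] at h2
      rw [h2]
      refine enat_aux h1 ?_ ?_ (enat_mul_ne_top hfin) (enat_mul_ne_top hfin)
      · rw [← h2, LL_range M a rs (n + 1)]
        exact le_add_self
      · rw [← LL_one]
        exact LL_le _ _ _
    rw [isWeaklyRegular_cons_iff]
    refine ⟨?_, ih _ hm' (by rwa [LL_one]) ?_⟩
    · refine IsSMulRegular.of_right_eq_zero_of_smul fun m ham => ?_
      have hall : ∀ n, m ∈ Ideal.ofList (a :: rs) ^ (n + 1) • (⊤ : Submodule R M) := by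
        intro n
        have hinj : Function.Injective (mulMap M a rs (n + 1)) := by
          have h1 := LL_range M a rs (n + 1)
          rw [(key n).1] at h1
          have hf : LL M (a :: rs) (n + 1) ≠ ⊤ := by
            rw [h n]; exact enat_mul_ne_top hfin
          have h0 : Module.length R (LinearMap.ker (mulMap M a rs (n + 1))) = 0 := by
            have h1' : 0 + LL M (a :: rs) (n + 1) = Module.length R (LinearMap.ker (mulMap M a rs (n + 1))) + LL M (a :: rs) (n + 1) := by
              rw [zero_add]; exact h1
            exact ((ENat.add_left_injective_of_ne_top hf) h1').symm
          rw [Module.length_eq_zero_iff, Submodule.subsingleton_iff_eq_bot] at h0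
          exact LinearMap.ker_eq_bot.mp h0
        refine (mulMap_injective_iff M a rs (n + 1)).mp hinj m ?_
        rw [ham]; exact zero_mem _
      have hk := Ideal.iInf_pow_smul_eq_bot_of_isLocalRing (M := M) (Ideal.ofList (a :: rs)) (by
        intro htop
        have : Ideal.ofList (a :: rs) ≤ maximalIdeal R := Ideal.span_le.mpr hm
        rw [htop] at this
        exact (maximalIdeal.isMaximal R).ne_top (top_le_iff.mp this))
      rw [← Submodule.mem_bot R, ← hk, Submodule.mem_iInf]
      intro n
      exact Submodule.smul_mono_left (Ideal.pow_le_pow_right (Nat.le_succ n)) (hall n)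
    · intro n
      cases n with
      | zero => simp
      | succ n => rw [(key n).2, LL_one]
end loc

section part2
open RingTheory.Sequence Pointwise
universe u v w
variable {R : Type u} [CommRing R] [IsLocalRing R] [IsNoetherianRing R]

lemma supportDim_mono {M N : Type*} [AddCommGroup M] [Module R M] [AddCommGroup N] [Module R N]
    (h : Module.support R M ⊆ Module.support R N) :
    Module.supportDim R M ≤ Module.supportDim R N :=
  Order.krullDim_le_of_strictMono (fun a ↦ ⟨a.1, h a.2⟩) (fun {_ _} lt ↦ lt)

lemma supportDim_le_zero {N : Type*} [AddCommGroup N] [Module R N] [Module.Finite R N]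
    (h : IsFiniteLength R N) : Module.supportDim R N ≤ 0 := by
  have hart : IsArtinian R N := ((isFiniteLength_iff_isNoetherian_isArtinian).mp h).2
  let f : ℕ →o (Submodule R N)ᵒᵈ :=
    ⟨fun n => OrderDual.toDual ((maximalIdeal R) ^ n • (⊤ : Submodule R N)), fun a b hab =>
      OrderDual.toDual_le_toDual.mpr (Submodule.smul_mono_left (Ideal.pow_le_pow_right hab))⟩
  obtain ⟨k, hk⟩ := IsArtinian.monotone_stabilizes f
  have hk1 : (maximalIdeal R) ^ k • (⊤ : Submodule R N) =
      (maximalIdeal R) ^ (k + 1) • (⊤ : Submodule R N) := hk (k + 1) (Nat.le_succ k)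
  have hbot : (maximalIdeal R) ^ k • (⊤ : Submodule R N) = ⊥ := by
    refine Submodule.eq_bot_of_le_smul_of_le_jacobson_bot (maximalIdeal R) _
      (IsNoetherian.noetherian _) ?_ (maximalIdeal_le_jacobson _)
    rw [← Submodule.mul_smul, ← pow_succ', ← hk1]
  have hsub : ∀ p ∈ Module.support R N, p.asIdeal = maximalIdeal R := by
    intro p hp
    rw [Module.mem_support_iff_of_finite] at hp
    have h1 : (maximalIdeal R) ^ k ≤ p.asIdeal := by
      refine le_trans (fun r hr => ?_) hp
      rw [Module.mem_annihilator]
      intro m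
      rw [← Submodule.mem_bot R, ← hbot]
      exact Submodule.smul_mem_smul hr trivial
    exact le_antisymm (le_maximalIdeal p.isPrime.ne_top) (p.isPrime.le_of_pow_le h1)
  have : Subsingleton (Module.support R N) :=
    ⟨fun p q => Subtype.ext (PrimeSpectrum.ext ((hsub _ p.2).trans (hsub _ q.2).symm))⟩
  exact Order.krullDim_nonpos_of_subsingleton

lemma dim_le (xs : List R) : ∀ (M : Type v) [AddCommGroup M] [Module R M] [Module.Finite R M],
    (∀ r ∈ xs, r ∈ maximalIdeal R) →
    Module.supportDim R M ≤
      Module.supportDim R (M ⧸ (Ideal.ofList xs • (⊤ : Submodule R M))) + xs.length := by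
  induction xs with
  | nil =>
    intro M _ _ _ _
    rw [Ideal.ofList_nil, Submodule.bot_smul]
    simpa using (Module.supportDim_eq_of_equiv (Submodule.quotEquivOfEqBot ⊥ rfl).symm).le
  | cons a xs ih =>
    intro M _ _ _ hm
    refine (Module.supportDim_le_supportDim_quotSMulTop_succ (x := a) (hm a (by simp))).trans ?_
    rw [Module.supportDim_eq_of_equiv
      (Submodule.quotOfListConsSMulTopEquivQuotSMulTopInner M a xs)]
    rw [List.length_cons, Nat.cast_add, ← add_assoc, Nat.cast_one]
    gcongr
    exact ih _ fun r hr => hm r (by simp [hr])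

lemma length_le_dim_sub (ys : List R) :
    ∀ (M N : Type v) [AddCommGroup M] [Module R M] [Module.Finite R M]
      [AddCommGroup N] [Module R N] [Module.Finite R N] [Nontrivial N] (f : N →ₗ[R] M),
    (∀ r ∈ ys, r ∈ maximalIdeal R) → IsWeaklyRegular M ys → Function.Injective f →
    (ys.length : WithBot ℕ∞) ≤ Module.supportDim R N := by
  induction ys with
  | nil =>
    intro M N _ _ _ _ _ _ _ f _ _ _
    have := (Module.supportDim_ne_bot_iff_nontrivial R N).mpr inferInstance
    obtain ⟨k, hk⟩ := WithBot.ne_bot_iff_exists.mp this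
    rw [← hk]
    simp
  | cons a ys ih =>
    intro M N _ _ _ _ _ _ _ f hm hreg hf
    rw [isWeaklyRegular_cons_iff] at hreg
    have ha := hm a (by simp)
    let N' : Submodule R M := Submodule.torsionBySet R M (Module.annihilator R N : Set R)
    have hfN : ∀ n, f n ∈ N' := by
      intro n
      rw [Submodule.mem_torsionBySet_iff]
      rintro ⟨r, hr⟩
      change r • f n = 0
      rw [← map_smul, Module.mem_annihilator.mp hr, map_zero]
    have hnt : Nontrivial N' := by
      obtain ⟨n, hn⟩ := exists_ne (0 : N)
      refine ⟨⟨⟨f n, hfN n⟩, 0, fun h => hn (hf ?_)⟩⟩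
      rw [map_zero]
      exact congrArg Subtype.val h
    have hle : Module.supportDim R N' ≤ Module.supportDim R N := by
      refine supportDim_mono fun p hp => ?_
      rw [Module.mem_support_iff_of_finite] at hp ⊢
      refine le_trans (fun r hr => ?_) hp
      rw [Module.mem_annihilator]
      rintro ⟨m, hm⟩
      exact Subtype.ext ((Submodule.mem_torsionBySet_iff _ _).mp hm ⟨r, hr⟩)
    refine le_trans ?_ hle
    have hregN : IsSMulRegular N' a := hreg.1.submodule N' a
    rw [← Module.supportDim_quotSMulTop_succ_eq_supportDim hregN ha]
    rw [List.length_cons, Nat.cast_add, Nat.cast_one]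
    gcongr
    have := nontrivial_quotSMulTop_of_mem_maximalIdeal N' ha
    refine ih (QuotSMulTop a M) (QuotSMulTop a N') (QuotSMulTop.map a N'.subtype)
      (fun r hr => hm r (by simp [hr])) hreg.2 ?_
    rw [injective_iff_map_eq_zero, (Submodule.mkQ_surjective _).forall]
    rintro ⟨m, hm⟩ h0
    have h1 : Submodule.mkQ (a • (⊤ : Submodule R M)) m = 0 := h0
    rw [Submodule.mkQ_apply, Submodule.Quotient.mk_eq_zero] at h1
    obtain ⟨z, -, rfl⟩ := h1
    have hz : z ∈ N' := by
      rw [Submodule.mem_torsionBySet_iff] at hm ⊢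
      intro r
      have := hm r
      apply hreg.1
      change a • (r : R) • z = a • 0
      rw [smul_zero, smul_comm]
      exact this
    rw [Submodule.mkQ_apply, Submodule.Quotient.mk_eq_zero]
    exact ⟨⟨z, hz⟩, trivial, rfl⟩

open CategoryTheory Abelian in
lemma exchange_small [Small.{w} R] (M : Type w) [AddCommGroup M] [Module R M] [Module.Finite R M]
    [Nontrivial M] (ys : List R) (hm : ∀ r ∈ ys, r ∈ maximalIdeal R) (hreg : IsWeaklyRegular M ys)
    (n : ℕ) (hn : ys.length = n + 1) (b : R) (hb : b ∈ maximalIdeal R) (hbr : IsSMulRegular M b) :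
    ∃ zs : List R, zs.length = n ∧ (∀ r ∈ zs, r ∈ maximalIdeal R) ∧
      IsRegular (QuotSMulTop b M) zs := by
  have hlt : ∀ (L : Type w) [AddCommGroup L] [Module R L] [Module.Finite R L] [Nontrivial L],
      (maximalIdeal R) • (⊤ : Submodule R L) < ⊤ := fun L _ _ _ _ =>
    lt_top_iff_ne_top.mpr (Submodule.top_ne_ideal_smul_of_le_jacobson_annihilator
      (maximalIdeal_le_jacobson _)).symm
  have h1 := ((ModuleCat.exists_isRegular_tfae (maximalIdeal R) (n + 1) (ModuleCat.of R M)
    (hlt M)).out 3 1 :).mp ⟨ys, hn, hm, IsRegular.of_isWeaklyRegular_of_mem_maximalIdeal M hm hreg⟩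
  have := nontrivial_quotSMulTop_of_mem_maximalIdeal M hb
  refine ((ModuleCat.exists_isRegular_tfae (maximalIdeal R) n (ModuleCat.of R (QuotSMulTop b M))
    (hlt _)).out 1 3).mp ?_
  intro i hi
  have zero1 := AddCommGrpCat.isZero_of_iff_subsingleton.mpr (h1 i (by omega))
  have zero2 := AddCommGrpCat.isZero_of_iff_subsingleton.mpr (h1 (i + 1) (by omega))
  exact AddCommGrpCat.subsingleton_of_isZero <| ShortComplex.Exact.isZero_of_both_zeros
        ((Ext.covariant_sequence_exact₃' _ (IsSMulRegular.smulShortComplex_shortExact (M := ModuleCat.of R M) hbr)) i (i + 1) rfl)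
        (zero1.eq_zero_of_src _) (zero2.eq_zero_of_tgt _)

lemma exchange (M : Type v) [AddCommGroup M] [Module R M] [Module.Finite R M]
    [Nontrivial M] (ys : List R) (hm : ∀ r ∈ ys, r ∈ maximalIdeal R) (hreg : IsWeaklyRegular M ys)
    (n : ℕ) (hn : ys.length = n + 1) (b : R) (hb : b ∈ maximalIdeal R) (hbr : IsSMulRegular M b) :
    ∃ zs : List R, zs.length = n ∧ (∀ r ∈ zs, r ∈ maximalIdeal R) ∧
      IsRegular (QuotSMulTop b M) zs := by
  let e : M ≃ₗ[R] ULift.{u} M := ULift.moduleEquiv.symm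
  obtain ⟨zs, h1, h2, h3⟩ := exchange_small (ULift.{u} M) ys hm
    ((e.isWeaklyRegular_congr ys).mp hreg) n hn b hb ((e.isSMulRegular_congr b).mp hbr)
  exact ⟨zs, h1, h2, ((QuotSMulTop.congr b e).isRegular_congr zs).mpr h3⟩

lemma sop_reg (xs : List R) :
    ∀ (M : Type v) [AddCommGroup M] [Module R M] [Module.Finite R M] [Nontrivial M] (ys : List R),
    (∀ r ∈ xs, r ∈ maximalIdeal R) → (∀ r ∈ ys, r ∈ maximalIdeal R) → ys.length = xs.length →
    IsWeaklyRegular M ys →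
    Module.supportDim R (M ⧸ (Ideal.ofList xs • (⊤ : Submodule R M))) ≤ 0 →
    IsWeaklyRegular M xs := by
  induction xs with
  | nil => intro M _ _ _ _ _ _ _ _ _ _; exact .nil R M
  | cons a xs ih =>
    intro M _ _ _ _ ys hmx hmy hlen hreg hdim
    have ha := hmx a (by simp)
    have hmx' : ∀ r ∈ xs, r ∈ maximalIdeal R := fun r hr => hmx r (by simp [hr])
    have hareg : IsSMulRegular M a := by
      refine IsSMulRegular.of_right_eq_zero_of_smul fun m ham => ?_
      by_contra hm0
      let N : Submodule R M := Submodule.torsionBy R M a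
      have hnt : Nontrivial N := ⟨⟨⟨m, ham⟩, 0, fun h => hm0 (congrArg Subtype.val h)⟩⟩
      have h1 := length_le_dim_sub ys M N N.subtype hmy hreg N.injective_subtype
      have h2 := dim_le xs N hmx'
      have h3 : Module.supportDim R (N ⧸ (Ideal.ofList xs • (⊤ : Submodule R N))) ≤ 0 := by
        refine le_trans (supportDim_mono ?_) hdim
        rw [Module.support_quotient, Module.support_quotient]
        rintro p ⟨hp1, hp2⟩
        refine ⟨Module.support_subset_of_injective N.subtype N.injective_subtype hp1, ?_⟩
        rw [Module.mem_support_iff_of_finite] at hp1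
        rw [PrimeSpectrum.mem_zeroLocus, SetLike.coe_subset_coe] at hp2 ⊢
        rw [Ideal.ofList_cons]
        refine sup_le ((Ideal.span_singleton_le_iff_mem _).mpr (hp1 ?_)) hp2
        rw [Module.mem_annihilator]
        rintro ⟨z, hz⟩
        exact Subtype.ext hz
      have h4 : ((xs.length + 1 : ℕ) : WithBot ℕ∞) ≤ (xs.length : ℕ) := by
        rw [hlen, List.length_cons] at h1
        refine h1.trans (h2.trans ?_)
        calc _ ≤ (0 : WithBot ℕ∞) + xs.length := by gcongr
          _ = _ := by simp
      have h5 : xs.length + 1 ≤ xs.length := by exact_mod_cast h4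
      omega
    rw [isWeaklyRegular_cons_iff]
    refine ⟨hareg, ?_⟩
    obtain ⟨zs, h1, h2, h3⟩ := exchange M ys hmy hreg xs.length hlen a ha hareg
    have := nontrivial_quotSMulTop_of_mem_maximalIdeal M ha
    refine ih (QuotSMulTop a M) zs hmx' h2 h1 h3.1 ?_
    rwa [← Module.supportDim_eq_of_equiv
      (Submodule.quotOfListConsSMulTopEquivQuotSMulTopInner M a xs)]

end part2

section bridge
open RingTheory.Sequence

lemma moduleLength_eq (R : Type*) [CommRing R] (M : Type*) [AddCommGroup M] [Module R M] :
    moduleLength R M = (Module.length R M : WithBot ℕ∞) :=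
  (Module.coe_length R M).symm

lemma moduleDim_eq (R : Type*) [CommRing R] (M : Type*) [AddCommGroup M] [Module R M]
    [Module.Finite R M] : moduleDim R M = Module.supportDim R M :=
  (Module.supportDim_eq_ringKrullDim_quotient_annihilator R M).symm

lemma isCM_iff {R : Type*} [CommRing R] [IsLocalRing R] [IsNoetherianRing R]
    {M : Type*} [AddCommGroup M] [Module R M] [Module.Finite R M]
    {d : ℕ} (hd : moduleDim R M = (d : WithBot ℕ∞)) :
    IsCM R M ↔ ∃ ys : List R, ys.length = d ∧ (∀ r ∈ ys, r ∈ maximalIdeal R) ∧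
      IsWeaklyRegular M ys := by
  have hnt : Nontrivial M := by
    rw [moduleDim_eq] at hd
    refine (Module.supportDim_ne_bot_iff_nontrivial R M).mp ?_
    rw [hd]
    exact WithBot.coe_ne_bot
  rw [IsCM, hd]
  constructor
  · intro h
    have h' : moduleDepth R M = (d : ℕ∞) := by exact_mod_cast h
    have hne : Nonempty {n : ℕ∞ | ∃ rs : List R,
      (rs.length : ℕ∞) = n ∧ (∀ r ∈ rs, r ∈ maximalIdeal R) ∧ IsRegular M rs} :=
      ⟨0, [], by simp, by simp, IsRegular.nil R M⟩
    have hmem := ENat.sSup_mem_of_nonempty_of_lt_top (s := {n : ℕ∞ | ∃ rs : List R,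
      (rs.length : ℕ∞) = n ∧ (∀ r ∈ rs, r ∈ maximalIdeal R) ∧ IsRegular M rs}) (by
        change moduleDepth R M < ⊤
        rw [h']; exact ENat.natCast_lt_top d)
    change moduleDepth R M ∈ _ at hmem
    rw [h'] at hmem
    obtain ⟨ys, h1, h2, h3⟩ := hmem
    exact ⟨ys, by exact_mod_cast h1, h2, h3.1⟩
  · rintro ⟨ys, h1, h2, h3⟩
    have : moduleDepth R M = (d : ℕ∞) := by
      refine le_antisymm (sSup_le ?_) (le_sSup ⟨ys, by rw [h1], h2,
        IsRegular.of_isWeaklyRegular_of_mem_maximalIdeal M h2 h3⟩)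
      rintro _ ⟨rs, rfl, hr, hreg⟩
      have h4 := length_le_dim_sub rs M M LinearMap.id hr hreg.1 Function.injective_id
      rw [← moduleDim_eq, hd] at h4
      exact_mod_cast h4
    rw [this]
    rfl

end bridge

/-- **Lemma 4.2.** For a parameter ideal `q` of `M`,
`ℓ(M/q^{n+1}M) ≤ C(n+d, d)·ℓ(M/qM)` for all `n ≥ 0`, with equality for all
`n` iff `M` is Cohen-Macaulay. -/
theorem stmt_18 {R : Type*} [CommRing R] [IsLocalRing R] [IsNoetherianRing R]
    {M : Type*} [AddCommGroup M] [Module R M] [Module.Finite R M]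
    {d : ℕ} (hd : moduleDim R M = (d : WithBot ℕ∞))
    (x : Fin d → R) (hx : IsSOP R M x) :
    (∀ n : ℕ,
        moduleLength R (M ⧸ ((Ideal.span (Set.range x)) ^ (n + 1) • (⊤ : Submodule R M))) ≤
          ((n + d).choose d : WithBot ℕ∞) *
            moduleLength R (M ⧸ (Ideal.span (Set.range x) • (⊤ : Submodule R M)))) ∧
      ((∀ n : ℕ,
          moduleLength R (M ⧸ ((Ideal.span (Set.range x)) ^ (n + 1) • (⊤ : Submodule R M))) =
            ((n + d).choose d : WithBot ℕ∞) *
              moduleLength R (M ⧸ (Ideal.span (Set.range x) • (⊤ : Submodule R M)))) ↔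
        IsCM R M) := by
  have hI : Ideal.span (Set.range x) = Ideal.ofList (List.ofFn x) := by
    rw [Ideal.ofList]
    congr 1
    ext r
    simp [List.mem_ofFn]
  have hlen : (List.ofFn x).length = d := List.length_ofFn
  obtain ⟨hxm, hfl⟩ := hx
  have hm : ∀ r ∈ List.ofFn x, r ∈ maximalIdeal R := by
    intro r hr
    obtain ⟨i, rfl⟩ := List.mem_ofFn.mp hr
    exact hxm i
  rw [hI] at hfl
  rw [hI]
  have hL1 : moduleLength R (M ⧸ (Ideal.ofList (List.ofFn x) • (⊤ : Submodule R M))) =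
      ((LL M (List.ofFn x) 1 : ℕ∞) : WithBot ℕ∞) := by
    rw [moduleLength_eq, LL, pow_one]
  have hL : ∀ n : ℕ, moduleLength R
      (M ⧸ (Ideal.ofList (List.ofFn x) ^ (n + 1) • (⊤ : Submodule R M))) =
      ((LL M (List.ofFn x) (n + 1) : ℕ∞) : WithBot ℕ∞) := fun n => by
    rw [moduleLength_eq, LL]
  have hR : ∀ n : ℕ, ((n + d).choose d : WithBot ℕ∞) * ((LL M (List.ofFn x) 1 : ℕ∞) : WithBot ℕ∞)
      = (((((n + d).choose d : ℕ) : ℕ∞) * LL M (List.ofFn x) 1 : ℕ∞) : WithBot ℕ∞) := fun n => by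
    rw [WithBot.coe_mul]; rfl
  simp only [hL1, hL, hR, WithBot.coe_le_coe, WithBot.coe_inj]
  have hnt : Nontrivial M := by
    rw [moduleDim_eq] at hd
    refine (Module.supportDim_ne_bot_iff_nontrivial R M).mp ?_
    rw [hd]
    exact WithBot.coe_ne_bot
  refine ⟨fun n => ?_, ?_⟩
  · have := LL_le (List.ofFn x) M n
    rwa [hlen] at this
  · rw [isCM_iff hd]
    constructor
    · intro h
      refine ⟨List.ofFn x, hlen, hm, reg_of_LL_eq _ M hm ?_ ?_⟩
      · rw [LL, pow_one]
        exact Module.length_ne_top_iff.mpr hfl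
      · rw [hlen]; exact h
    · rintro ⟨ys, h1, h2, h3⟩ n
      have hreg := sop_reg (List.ofFn x) M ys hm h2 (h1.trans hlen.symm) h3
        (supportDim_le_zero hfl)
      have := LL_eq (List.ofFn x) M n hm hreg
      rwa [hlen] at this
end
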